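/- arXiv:1406.2999 — 2 statements merged into one kernel-verified Lean document; each statement's English description precedes it below -/
import Mathlib

section
/- Let p ≥ 5 be a prime, let k be a positive integer, let F ∈ ℤ_(p)[Q,R] be isobaric of weight k and not involving P, and let n be the unique integer with 0 ≤ np−k+1 < p. Then θ^{np−k+1}F lies in the ideal (A^{np−k+1}, p) of ℤ_(p)[P,Q,R]; that is, there exist polynomials G, H ∈ ℤ_(p)[P,Q,R] with θ^{np−k+1}F = A^{np−k+1}·G + p·H. -/
open MvPolynomial Finset

noncomputable section

/-- `x` lies in `ℤ_(p) ⊆ ℚ`: `p` does not divide the reduced denominator of `x`. -/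
def pInt (p : ℕ) (x : ℚ) : Prop := ¬ p ∣ x.den

/-- The polynomial ring `ℚ[P,Q,R]`, with `P = X 0`, `Q = X 1`, `R = X 2`. -/
abbrev Poly3 : Type := MvPolynomial (Fin 3) ℚ

/-- `f` has all of its coefficients in `ℤ_(p)`. -/
def polyPInt (p : ℕ) (f : Poly3) : Prop := ∀ m : Fin 3 →₀ ℕ, pInt p (coeff m f)

/-- `f` is isobaric of weight `w`, where `P, Q, R` have weights `2, 4, 6`. -/
def Isobaric (w : ℕ) (f : Poly3) : Prop :=
  ∀ m ∈ f.support, 2 * m 0 + 4 * m 1 + 6 * m 2 = w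

/-- `f` does not involve the variable `P`. -/
def NoP (f : Poly3) : Prop := ∀ m ∈ f.support, m 0 = 0

/-- The Ramanujan derivation `D` on `ℚ[P,Q,R]`, the unique derivation with
`DP = (P²-Q)/12`, `DQ = (PQ-R)/3`, `DR = (PR-Q²)/2`. -/
def Dop (f : Poly3) : Poly3 :=
  C (1/12 : ℚ) * (X 0 ^ 2 - X 1) * pderiv 0 f
    + C (1/3 : ℚ) * (X 0 * X 1 - X 2) * pderiv 1 f
    + C (1/2 : ℚ) * (X 0 * X 2 - X 1 ^ 2) * pderiv 2 f

/-- The sum of the `j`-th powers of the divisors of `n`, as a rational number. -/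
def sigmaQ (j n : ℕ) : ℚ := ∑ d ∈ n.divisors, (d : ℚ) ^ j

/-- The q-expansion of `E₂`. -/
def E2s : PowerSeries ℚ := PowerSeries.mk fun n => if n = 0 then 1 else -24 * sigmaQ 1 n

/-- The q-expansion of `E₄`. -/
def E4s : PowerSeries ℚ := PowerSeries.mk fun n => if n = 0 then 1 else 240 * sigmaQ 3 n

/-- The q-expansion of `E₆`. -/
def E6s : PowerSeries ℚ := PowerSeries.mk fun n => if n = 0 then 1 else -504 * sigmaQ 5 n

/-- The q-expansion of the normalized Eisenstein series `E_{p-1}`. -/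
def EAs (p : ℕ) : PowerSeries ℚ :=
  PowerSeries.mk fun n => if n = 0 then 1 else
    -(2 * ((p : ℚ) - 1) / bernoulli (p - 1)) * sigmaQ (p - 2) n

/-- The q-expansion of the normalized Eisenstein series `E_{p+1}`. -/
def EBs (p : ℕ) : PowerSeries ℚ :=
  PowerSeries.mk fun n => if n = 0 then 1 else
    -(2 * ((p : ℚ) + 1) / bernoulli (p + 1)) * sigmaQ p n

/-- `Φ : ℚ[P,Q,R] → ℚ[[q]]`, the algebra map sending `P, Q, R` to `E₂, E₄, E₆`. -/
def Phi : Poly3 →ₐ[ℚ] PowerSeries ℚ := aeval ![E2s, E4s, E6s]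

/-- The theta operator attached to the polynomials `A` and `B`:
`θf = ((BQ-AR)/3)·∂f/∂Q + ((BR-AQ²)/2)·∂f/∂R`. -/
def thetaOp (A B f : Poly3) : Poly3 :=
  C (1/3 : ℚ) * (B * X 1 - A * X 2) * pderiv 1 f
    + C (1/2 : ℚ) * (B * X 2 - A * X 1 ^ 2) * pderiv 2 f

/-- `f` lies in the `n`-th power of the ideal `(A^p, p)` of `ℤ_(p)[P,Q,R]`. -/
def InIdealPow (p : ℕ) (A : Poly3) (n : ℕ) (f : Poly3) : Prop :=
  ∃ G : ℕ → Poly3, (∀ i, polyPInt p (G i)) ∧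
    f = ∑ i ∈ Finset.range (n + 1), (p : Poly3) ^ (n - i) * A ^ (p * i) * G i


section Analytic
open UpperHalfPlane hiding I
open Complex Function
open scoped Manifold MatrixGroups ModularForm Topology


def HasQ (f : ℍ → ℂ) (c : PowerSeries ℂ) : Prop :=
  ∀ τ : ℍ, HasSum (fun m : ℕ => c.coeff m • Periodic.qParam 1 τ ^ m) (f τ)

lemma HasQ.add {f g : ℍ → ℂ} {c d : PowerSeries ℂ} (hf : HasQ f c) (hg : HasQ g d) :
    HasQ (f + g) (c + d) := by
  intro τ
  simpa [add_mul] using (hf τ).add (hg τ)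

lemma HasQ.smul {f : ℍ → ℂ} {c : PowerSeries ℂ} (hf : HasQ f c) (a : ℂ) :
    HasQ (a • f) (a • c) := by
  intro τ
  simpa [mul_assoc] using (hf τ).mul_left a

lemma HasQ.sub {f g : ℍ → ℂ} {c d : PowerSeries ℂ} (hf : HasQ f c) (hg : HasQ g d) :
    HasQ (f - g) (c - d) := by
  intro τ
  simpa [sub_mul] using (hf τ).sub (hg τ)

lemma HasQ.mul {f g : ℍ → ℂ} {c d : PowerSeries ℂ} (hf : HasQ f c) (hg : HasQ g d) :
    HasQ (f * g) (c * d) := by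
  intro τ
  have h1 := (hf τ)
  have h2 := (hg τ)
  have s1 := h1.summable.norm
  have s2 := h2.summable.norm
  have := (summable_norm_sum_mul_antidiagonal_of_summable_norm s1 s2).of_norm.hasSum
  rw [← tsum_mul_tsum_eq_tsum_sum_antidiagonal_of_summable_norm s1 s2, h1.tsum_eq, h2.tsum_eq] at this
  convert! this using 2 with n
  rw [PowerSeries.coeff_mul, Finset.sum_smul]
  refine Finset.sum_congr rfl fun x hx => ?_
  rw [← Finset.HasAntidiagonal.mem_antidiagonal.mp hx, pow_add]
  simp only [smul_eq_mul]; ring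

lemma HasQ.periodic {f : ℍ → ℂ} {c : PowerSeries ℂ} (hf : HasQ f c) :
    Periodic (f ∘ ofComplex) ((1 : ℝ) : ℂ) := by
  intro w
  by_cases hw : 0 < w.im
  · have hw' : 0 < (w + ((1 : ℝ) : ℂ)).im := by simpa using hw
    simp only [Function.comp_apply, ofComplex_apply_of_im_pos hw, ofComplex_apply_of_im_pos hw']
    have h1 := hf ⟨w, hw⟩
    have h2 := hf ⟨w + ((1 : ℝ) : ℂ), hw'⟩
    refine h2.unique ?_
    convert! h1 using 4 with n
    simp only [Periodic.qParam, ofReal_one, div_one, mul_add, mul_one, Complex.exp_add,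
      Complex.exp_two_pi_mul_I]
  · have hw' : ¬ 0 < (w + ((1 : ℝ) : ℂ)).im := by simpa using hw
    simp only [Function.comp_apply]
    rw [ofComplex_apply_of_im_nonpos (not_lt.mp hw), ofComplex_apply_of_im_nonpos (not_lt.mp hw')]

lemma HasQ.analyticAt {f : ℍ → ℂ} {c : PowerSeries ℂ} (hf : HasQ f c) (hd : MDiff f) :
    AnalyticAt ℂ (cuspFunction 1 f) 0 :=
  analyticAt_cuspFunction_zero one_pos hf.periodic hd
    (isBoundedAtImInfty_of_hasSum_qExpansion one_pos hf)

lemma HasQ.eq_qExpansion {f : ℍ → ℂ} {c : PowerSeries ℂ} (hf : HasQ f c) (hd : MDiff f) :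
    c = qExpansion 1 f := by
  ext m
  have h1 := (hasFPowerSeriesOnBall_cuspFunction (f := f) (c := fun m => c.coeff m) one_pos
    (hf.analyticAt hd) hf).hasFPowerSeriesAt
  have h2 := (hf.analyticAt hd).hasFPowerSeriesAt
  have := congr_arg (FormalMultilinearSeries.coeff · m) (h1.eq_formalMultilinearSeries h2)
  rw [qExpansion_coeff]
  simpa [div_eq_mul_inv, mul_comm] using this

lemma HasQ.deriv {f : ℍ → ℂ} {c : PowerSeries ℂ} (hf : HasQ f c) (hd : MDiff f) :
    HasQ (Derivative.normalizedDerivOfComplex f)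
      (PowerSeries.X * PowerSeries.derivative ℂ c) := by
  have hb := isBoundedAtImInfty_of_hasSum_qExpansion one_pos hf
  have hdo := differentiableOn_cuspFunction_ball one_pos hf.periodic hd hb
  have hdo' := hdo.deriv Metric.isOpen_ball
  intro τ
  set q := Periodic.qParam 1 τ with hq
  have hqn : ‖q‖ < 1 := Periodic.norm_qParam_lt_one one_pos τ.im_pos
  have key := hasSum_taylorSeries_on_ball hdo' (z := q) (by simpa using hqn)
  have hcoef : ∀ n, ((n.factorial : ℂ))⁻¹ * iteratedDeriv (n+1) (cuspFunction 1 f) 0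
      = (n+1) * c.coeff (n+1) := by
    intro n
    rw [hf.eq_qExpansion hd, qExpansion_coeff, Nat.factorial_succ]
    push_cast
    have : (n.factorial : ℂ) ≠ 0 := by exact_mod_cast n.factorial_ne_zero
    have : (n + 1 : ℂ) ≠ 0 := by exact_mod_cast n.succ_ne_zero
    field_simp
  have hD : Derivative.normalizedDerivOfComplex f τ = q * _root_.deriv (cuspFunction 1 f) q := by
    have hcomp : f ∘ ofComplex = fun w => cuspFunction 1 f (Periodic.qParam 1 w) := by
      funext w
      rw [cuspFunction, Periodic.eq_cuspFunction one_ne_zero hf.periodic]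
    have h1 : HasDerivAt (fun w : ℂ => Periodic.qParam 1 w) (q * (2 * Real.pi * I)) τ := by
      have : HasDerivAt (fun w : ℂ => 2 * Real.pi * I * w / ((1:ℝ) : ℂ)) (2 * Real.pi * I) τ := by
        simpa using ((hasDerivAt_id (τ : ℂ)).const_mul (2 * Real.pi * I))
      exact this.cexp
    have h2 : HasDerivAt (cuspFunction 1 f) (_root_.deriv (cuspFunction 1 f) q) q :=
      (differentiableAt_cuspFunction one_pos hf.periodic hd hb hqn).hasDerivAt
    rw [Derivative.normalizedDerivOfComplex, hcomp]
    have h3 := (h2.comp (τ : ℂ) h1).deriv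
    rw [Function.comp_def] at h3
    rw [h3]
    have : (2 * Real.pi * I : ℂ) ≠ 0 := by simp [Real.pi_ne_zero]
    field_simp
  rw [hD, ← hasSum_nat_add_iff' 1]
  simp only [Finset.range_one, Finset.sum_singleton]
  convert! key.mul_left q using 1
  · funext n
    rw [← iteratedDeriv_succ', PowerSeries.coeff_succ_X_mul]
    have := hcoef n
    rw [PowerSeries.coeff_derivative]
    simp only [smul_eq_mul, sub_zero]
    rw [pow_succ]
    linear_combination (-(q^n*q)) * this
  · simp

lemma HasQ.eq_zero {f : ℍ → ℂ} {c : PowerSeries ℂ} (hf : HasQ f c) (hd : MDiff f) (k : ℕ)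
    (hk : k < 12) (hs : ∀ γ : SL(2, ℤ), f ∣[(k : ℤ)] γ = f) (h0 : c.coeff 0 = 0) : c = 0 := by
  have hb := isBoundedAtImInfty_of_hasSum_qExpansion one_pos hf
  let F : ModularForm 𝒮ℒ (k : ℤ) :=
    { toFun := f
      slash_action_eq' := by
        intro A ⟨γ, hγ⟩
        rw [← hγ]; exact hs γ
      holo' := hd
      bdd_at_cusps' := by
        intro c hc
        rw [Subgroup.IsArithmetic.isCusp_iff_isCusp_SL2Z] at hc
        rw [OnePoint.isBoundedAt_iff_forall_SL2Z hc]
        intro γ hγ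
        rw [hs γ]; exact hb }
  have hF : F = 0 := by
    apply ModularForm.sturm_bound_levelOne_nat
    have : k / 12 = 0 := by omega
    rw [this]
    change ((0:ℕ) : ℕ∞) < (qExpansion 1 f).order
    rw [← hf.eq_qExpansion hd]
    rw [Nat.cast_zero, pos_iff_ne_zero, ne_eq, ← ne_eq, PowerSeries.order_ne_zero_iff_constCoeff_eq_zero]
    simpa using h0
  have : f = 0 := congrArg DFunLike.coe hF
  rw [hf.eq_qExpansion hd, this, qExpansion_zero]

open EisensteinSeries in
lemma slash_DE2 (γ : SL(2, ℤ)) :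
    (Derivative.normalizedDerivOfComplex E2 - (12⁻¹ : ℂ) • (E2 * E2)) ∣[((4 : ℕ) : ℤ)] γ =
      Derivative.normalizedDerivOfComplex E2 - (12⁻¹ : ℂ) • (E2 * E2) := by
  have hD := Derivative.normalizedDerivOfComplex_SL_slash (k := 2) E2_mdifferentiable (γ := γ)
  have hm := ModularForm.mul_slash_SL2 2 2 γ E2 E2
  rw [E2_slash_action] at hD hm
  have h4 : ((4 : ℕ) : ℤ) = 2 + 2 := by norm_num
  rw [h4, sub_eq_add_neg, SlashAction.add_slash, SlashAction.neg_slash, ModularForm.SL_smul_slash, hm]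
  have hpi : (Real.pi : ℂ) ≠ 0 := by simp [Real.pi_ne_zero]
  ext z
  have hz : denom (γ : GL (Fin 2) ℝ) z ≠ 0 := denom_ne_zero _ z
  have hDz := congrFun hD z
  have hder : Derivative.normalizedDerivOfComplex (E2 - (1 / (2 * riemannZeta 2)) • D2 γ) z =
      Derivative.normalizedDerivOfComplex E2 z + (1 / (2 * riemannZeta 2)) *
        (((γ 1 0 : ℤ) : ℂ) / denom (γ : GL (Fin 2) ℝ) z) ^ 2 := by
    unfold Derivative.normalizedDerivOfComplex
    have h1 := (mdifferentiableAt_iff.mp (E2_mdifferentiable z)).hasDerivAt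
    have h2 := hasDerivAt_denom_zpow (γ : GL (Fin 2) ℝ) (-1) z
    have h3 : HasDerivAt ((E2 - (1 / (2 * riemannZeta 2)) • D2 γ) ∘ ofComplex) _ z :=
      (h1.sub (h2.const_mul (1 / (2 * riemannZeta 2) * (2 * Real.pi * I * γ 1 0)))).congr_of_eventuallyEq (by
        filter_upwards [isOpen_upperHalfPlaneSet.mem_nhds z.im_pos] with w hw
        simp only [Function.comp_apply, Pi.sub_apply, Pi.smul_apply, smul_eq_mul, D2,
          ofComplex_apply_of_im_pos hw]
        rw [zpow_neg_one]
        ring_nf)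
    rw [h3.deriv]
    have e : (-1 - 1 : ℤ) = -2 := rfl
    simp only [e, zpow_neg]
    simp
    have hz2 : riemannZeta 2 ≠ 0 := by rw [riemannZeta_two]; simp [hpi]
    field_simp
    norm_cast
    ring_nf
    simp [I_sq]
  rw [hder] at hDz
  simp only [Pi.add_apply, Pi.sub_apply, Pi.neg_apply, Pi.smul_apply, Pi.mul_apply, smul_eq_mul, D2, riemannZeta_two] at hDz ⊢
  rw [show (2 + 2 : ℤ) = 4 from rfl] at hDz ⊢
  have : (Derivative.normalizedDerivOfComplex E2 ∣[(4 : ℤ)] γ) z = _ := (sub_eq_iff_eq_add.mp hDz.symm)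
  rw [this]
  push_cast
  field_simp
  ring_nf
  simp [I_sq]

end Analytic

section Ramanujan
open UpperHalfPlane hiding I
open Complex Function
open scoped Manifold MatrixGroups ModularForm Topology

lemma sigmaQ_eq (j n : ℕ) : sigmaQ j n = (ArithmeticFunction.sigma j n : ℚ) := by
  simp [sigmaQ, ArithmeticFunction.sigma_apply]

lemma HasQ_E2 : HasQ EisensteinSeries.E2 (PowerSeries.map (algebraMap ℚ ℂ) E2s) := by
  intro τ
  have h := EisensteinSeries.hasSum_qExpansion_E2 (z := τ)
  simp only [Function.Periodic.qParam, ofReal_one, div_one] 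
  convert! h using 3 with m
  simp only [E2s, PowerSeries.coeff_map, PowerSeries.coeff_mk, sigmaQ_eq]
  split_ifs <;> simp

lemma bern4 : bernoulli 4 = -1 / 30 := by
  rw [bernoulli_eq_bernoulli'_of_ne_one (by norm_num), bernoulli'_four]

lemma bern6 : bernoulli 6 = 1 / 42 := by
  have h5 : bernoulli' 5 = 0 := by
    rw [bernoulli'_def]
    norm_num [Finset.sum_range_succ, bernoulli'_zero, bernoulli'_one, bernoulli'_two, bernoulli'_three, bernoulli'_four, Nat.choose]
  rw [bernoulli_eq_bernoulli'_of_ne_one (by norm_num), bernoulli'_def]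
  norm_num [Finset.sum_range_succ, bernoulli'_zero, bernoulli'_one, bernoulli'_two, bernoulli'_three, bernoulli'_four, h5, Nat.choose]

lemma HasQ_E4 : HasQ (⇑(ModularForm.E (k := 4) (by norm_num)))
    (PowerSeries.map (algebraMap ℚ ℂ) E4s) := by
  intro τ
  have h := ModularForm.hasSum_qExpansion (f := ModularForm.E (k := 4) (by norm_num)) one_pos
    one_mem_strictPeriods_SL τ
  convert! h using 3 with m
  rw [EisensteinSeries.E_qExpansion_coeff _ ⟨2, rfl⟩]
  simp only [E4s, PowerSeries.coeff_map, PowerSeries.coeff_mk, sigmaQ_eq]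
  split_ifs
  · simp
  · norm_num [bern4]

lemma HasQ_E6 : HasQ (⇑(ModularForm.E (k := 6) (by norm_num)))
    (PowerSeries.map (algebraMap ℚ ℂ) E6s) := by
  intro τ
  have h := ModularForm.hasSum_qExpansion (f := ModularForm.E (k := 6) (by norm_num)) one_pos
    one_mem_strictPeriods_SL τ
  convert! h using 3 with m
  rw [EisensteinSeries.E_qExpansion_coeff _ ⟨3, rfl⟩]
  simp only [E6s, PowerSeries.coeff_map, PowerSeries.coeff_mk, sigmaQ_eq]
  split_ifs
  · simp
  · norm_num [bern6]

lemma slash_inv_form {k : ℤ} (f : ModularForm 𝒮ℒ k) (γ : SL(2, ℤ)) : (⇑f) ∣[k] γ = ⇑f :=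
  f.slash_action_eq' _ ⟨γ, rfl⟩

lemma map_derivQ (f : PowerSeries ℚ) :
    PowerSeries.map (algebraMap ℚ ℂ) (PowerSeries.X * PowerSeries.derivative ℚ f) =
      PowerSeries.X * PowerSeries.derivative ℂ (PowerSeries.map (algebraMap ℚ ℂ) f) := by
  rw [map_mul, PowerSeries.map_X]
  congr 1
  ext n
  simp [PowerSeries.coeff_derivative]

lemma mapQ_inj : Function.Injective (PowerSeries.map (algebraMap ℚ ℂ)) :=
  PowerSeries.map_injective _ (algebraMap ℚ ℂ).injective

lemma map_smulQ (a : ℚ) (f : PowerSeries ℚ) :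
    PowerSeries.map (algebraMap ℚ ℂ) (a • f) = (a : ℂ) • PowerSeries.map (algebraMap ℚ ℂ) f := by
  ext n; simp

lemma c0_X_mul (f : PowerSeries ℂ) : (PowerSeries.X * f).coeff 0 = 0 := by simp

lemma c0E2 : E2s.coeff 0 = 1 := by simp [E2s]
lemma c0E4 : E4s.coeff 0 = 1 := by simp [E4s]
lemma c0E6 : E6s.coeff 0 = 1 := by simp [E6s]

lemma ram2 : PowerSeries.X * PowerSeries.derivative ℚ E2s =
    (1/12 : ℚ) • (E2s * E2s - E4s) := by
  have h2 := HasQ_E2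
  have h4 := HasQ_E4
  have m2 := E2_mdifferentiable
  have m4 := (ModularForm.E (k := 4) (by norm_num)).holo'
  have H := ((h2.deriv m2).sub ((h2.mul h2).smul 12⁻¹)).add (h4.smul 12⁻¹)
  have := H.eq_zero (((Derivative.normalizedDerivOfComplex_mdifferentiable m2).sub
    ((m2.mul m2).const_smul _)).add (m4.const_smul _)) 4 (by norm_num) (by
      intro γ
      rw [SlashAction.add_slash, slash_DE2, ModularForm.SL_smul_slash]
      congr 2
      exact slash_inv_form _ γ) (by
      simp only [map_add, map_sub, c0_X_mul, PowerSeries.coeff_smul, ← map_mul, PowerSeries.coeff_map, c0E2, c0E4]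
      simp [c0E2, PowerSeries.coeff_mul])
  apply mapQ_inj
  rw [map_derivQ, map_smulQ, map_sub, map_mul]
  push_cast
  rw [smul_sub, one_div]
  linear_combination this

lemma ram4 : PowerSeries.X * PowerSeries.derivative ℚ E4s =
    (1/3 : ℚ) • (E2s * E4s - E6s) := by
  have h2 := HasQ_E2
  have h4 := HasQ_E4
  have h6 := HasQ_E6
  have m2 := E2_mdifferentiable
  have m4 := (ModularForm.E (k := 4) (by norm_num)).holo'
  have m6 := (ModularForm.E (k := 6) (by norm_num)).holo'
  have H := ((h4.deriv m4).sub ((h2.mul h4).smul 3⁻¹)).add (h6.smul 3⁻¹)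
  have := H.eq_zero (((Derivative.normalizedDerivOfComplex_mdifferentiable m4).sub
    ((m2.mul m4).const_smul _)).add (m6.const_smul _)) 6 (by norm_num) (by
      intro γ
      have e := Derivative.serreDerivative_slash_invariant m4 (slash_inv_form _ γ)
      have e2 : Derivative.serreDerivative ((4 : ℤ) : ℂ) (⇑(ModularForm.E (k := 4) (by norm_num))) =
        Derivative.normalizedDerivOfComplex (⇑(ModularForm.E (k := 4) (by norm_num))) - (3⁻¹ : ℂ) • (EisensteinSeries.E2 * (⇑(ModularForm.E (k := 4) (by norm_num)))) := by
        ext z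
        simp [Derivative.serreDerivative_apply]
        ring
      rw [SlashAction.add_slash, ModularForm.SL_smul_slash]
      congr 2
      · erw [← e2]; exact e
      · exact slash_inv_form _ γ) (by
      simp only [map_add, map_sub, c0_X_mul, PowerSeries.coeff_smul, ← map_mul, PowerSeries.coeff_map, c0E2, c0E4, c0E6]
      simp [c0E2, c0E4, PowerSeries.coeff_mul])
  apply mapQ_inj
  rw [map_derivQ, map_smulQ, map_sub, map_mul]
  push_cast
  rw [smul_sub, one_div]
  linear_combination this

lemma ram6 : PowerSeries.X * PowerSeries.derivative ℚ E6s =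
    (1/2 : ℚ) • (E2s * E6s - E4s * E4s) := by
  have h2 := HasQ_E2
  have h4 := HasQ_E4
  have h6 := HasQ_E6
  have m2 := E2_mdifferentiable
  have m4 := (ModularForm.E (k := 4) (by norm_num)).holo'
  have m6 := (ModularForm.E (k := 6) (by norm_num)).holo'
  have H := ((h6.deriv m6).sub ((h2.mul h6).smul 2⁻¹)).add ((h4.mul h4).smul 2⁻¹)
  have := H.eq_zero (((Derivative.normalizedDerivOfComplex_mdifferentiable m6).sub
    ((m2.mul m6).const_smul _)).add ((m4.mul m4).const_smul _)) 8 (by norm_num) (by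
      intro γ
      have e := Derivative.serreDerivative_slash_invariant m6 (slash_inv_form _ γ)
      have e2 : Derivative.serreDerivative ((6 : ℤ) : ℂ) (⇑(ModularForm.E (k := 6) (by norm_num))) =
        Derivative.normalizedDerivOfComplex (⇑(ModularForm.E (k := 6) (by norm_num))) - (2⁻¹ : ℂ) • (EisensteinSeries.E2 * (⇑(ModularForm.E (k := 6) (by norm_num)))) := by
        ext z
        simp [Derivative.serreDerivative_apply]
        ring
      rw [SlashAction.add_slash, ModularForm.SL_smul_slash]
      congr 2
      · erw [← e2]; exact e
      · have := ModularForm.mul_slash_SL2 4 4 γ (⇑(ModularForm.E (k := 4) (by norm_num))) (⇑(ModularForm.E (k := 4) (by norm_num)))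
        refine Eq.trans this ?_
        congr 1 <;> exact slash_inv_form _ γ) (by
      simp only [map_add, map_sub, c0_X_mul, PowerSeries.coeff_smul, ← map_mul, PowerSeries.coeff_map, c0E2, c0E4, c0E6]
      simp [c0E2, c0E4, c0E6, PowerSeries.coeff_mul])
  apply mapQ_inj
  rw [map_derivQ, map_smulQ, map_sub, map_mul, map_mul]
  push_cast
  rw [smul_sub, one_div]
  linear_combination this

end Ramanujan

section Arith

variable (p : ℕ) [hpf : Fact p.Prime]

/-- the ring of p-integral rationals -/
def SS : Subring ℚ := (PadicInt.subring p).comap (Rat.castHom ℚ_[p])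

lemma mem_SS (x : ℚ) : x ∈ SS p ↔ ‖(x : ℚ_[p])‖ ≤ 1 := Iff.rfl

lemma mem_SS_iff (x : ℚ) : x ∈ SS p ↔ pInt p x := by
  rw [mem_SS]
  constructor
  · intro h hd
    have h1 : (p : ℤ) ∣ x.num := by
      rw [← Padic.norm_intCast_lt_one_iff]
      have h2 : ((x.num : ℤ) : ℚ_[p]) = (x : ℚ_[p]) * (x.den : ℤ) := by
        have : (x.num : ℚ) = x * x.den := by rw [Rat.mul_den_eq_num]
        exact_mod_cast congrArg (Rat.cast : ℚ → ℚ_[p]) this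
      rw [h2, norm_mul]
      have h3 : ‖((x.den : ℤ) : ℚ_[p])‖ < 1 := by
        rw [Padic.norm_intCast_lt_one_iff]; exact_mod_cast hd
      calc _ ≤ 1 * ‖((x.den : ℤ) : ℚ_[p])‖ := by gcongr
        _ < 1 := by simpa using h3
    have h2 := x.reduced
    have h3 : p ∣ x.num.natAbs := Int.natCast_dvd.mp h1
    have := Nat.dvd_gcd h3 hd
    rw [h2] at this
    exact hpf.out.one_lt.ne' (Nat.dvd_one.mp this)
  · intro h; exact Padic.norm_rat_le_one h

/-- the embedding into p-adic integers -/
def toPadic : SS p →+* ℤ_[p] where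
  toFun x := ⟨(x : ℚ), x.2⟩
  map_one' := Subtype.ext (by simp)
  map_zero' := Subtype.ext (by simp)
  map_add' x y := Subtype.ext (by push_cast; rfl)
  map_mul' x y := Subtype.ext (by push_cast; rfl)

/-- reduction modulo p -/
def red : SS p →+* ZMod p := (PadicInt.toZMod).comp (toPadic p)

lemma red_eq_zero {x : SS p} (h : red p x = 0) : ∃ y : SS p, x = (p : SS p) * y := by
  have h1 : toPadic p x ∈ RingHom.ker (PadicInt.toZMod : ℤ_[p] →+* ZMod p) := h
  rw [PadicInt.ker_toZMod, PadicInt.maximalIdeal_eq_span_p, Ideal.mem_span_singleton] at h1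
  obtain ⟨c, hc⟩ := h1
  have hp0 : (p : ℚ) ≠ 0 := by exact_mod_cast hpf.out.ne_zero
  have hp0' : (p : ℚ_[p]) ≠ 0 := by exact_mod_cast hpf.out.ne_zero
  have hc' : (((x : ℚ) : ℚ_[p])) = p * (c : ℚ_[p]) := by
    have := congrArg (Subtype.val) hc
    rw [← PadicInt.coe_natCast, ← PadicInt.coe_mul]; exact this
  refine ⟨⟨(x : ℚ) / p, ?_⟩, ?_⟩
  · rw [mem_SS]
    push_cast
    rw [hc', mul_div_cancel_left₀ _ hp0']
    exact c.2
  · ext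
    push_cast
    field_simp

/-- `x` is p-integral and reduces to `c`. -/
def RedTo (x : ℚ) (c : ZMod p) : Prop := ∃ s : SS p, (s : ℚ) = x ∧ red p s = c

variable {p}

lemma RedTo.add {x y : ℚ} {c d : ZMod p} (hx : RedTo p x c) (hy : RedTo p y d) :
    RedTo p (x + y) (c + d) := by
  obtain ⟨h, rfl, rfl⟩ := hx
  obtain ⟨h', rfl, rfl⟩ := hy
  exact ⟨h + h', by push_cast; rfl, by rw [map_add]⟩

lemma RedTo.mul {x y : ℚ} {c d : ZMod p} (hx : RedTo p x c) (hy : RedTo p y d) :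
    RedTo p (x * y) (c * d) := by
  obtain ⟨h, rfl, rfl⟩ := hx
  obtain ⟨h', rfl, rfl⟩ := hy
  exact ⟨h * h', by push_cast; rfl, by rw [map_mul]⟩

lemma RedTo.neg {x : ℚ} {c : ZMod p} (hx : RedTo p x c) : RedTo p (-x) (-c) := by
  obtain ⟨h, rfl, rfl⟩ := hx
  exact ⟨-h, by push_cast; rfl, by rw [map_neg]⟩

lemma RedTo.nat (n : ℕ) : RedTo p (n : ℚ) (n : ZMod p) :=
  ⟨(n : SS p), by push_cast; rfl, by rw [map_natCast]⟩

lemma RedTo.int (n : ℤ) : RedTo p (n : ℚ) (n : ZMod p) :=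
  ⟨(n : SS p), by push_cast; rfl, by rw [map_intCast]⟩

lemma RedTo.inv {x : ℚ} {c : ZMod p} (hx : RedTo p x c) (hc : c ≠ 0) : RedTo p x⁻¹ c⁻¹ := by
  obtain ⟨s, rfl, rfl⟩ := hx
  have h1 : ¬ ‖toPadic p s‖ < 1 := by
    intro h1
    apply hc
    change (toPadic p s) ∈ RingHom.ker (PadicInt.toZMod : ℤ_[p] →+* ZMod p)
    rw [PadicInt.ker_toZMod, PadicInt.maximalIdeal_eq_span_p, Ideal.mem_span_singleton,
      ← PadicInt.norm_lt_one_iff_dvd]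
    exact h1
  have h2 : ‖((s : ℚ) : ℚ_[p])‖ = 1 := le_antisymm s.2 (not_lt.mp h1)
  have h3 : (s : ℚ)⁻¹ ∈ SS p := by rw [mem_SS]; push_cast; rw [norm_inv, h2]; simp
  have hx0 : (s : ℚ) ≠ 0 := by intro h; rw [h] at h2; simp at h2
  refine ⟨⟨_, h3⟩, rfl, eq_inv_of_mul_eq_one_left ?_⟩
  rw [← map_mul, ← map_one (red p)]
  congr 1
  ext
  push_cast
  field_simp

lemma RedTo.sum {ι : Type*} (s : Finset ι) (x : ι → ℚ) (c : ι → ZMod p)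
    (h : ∀ i ∈ s, RedTo p (x i) (c i)) : RedTo p (∑ i ∈ s, x i) (∑ i ∈ s, c i) := by
  classical
  induction s using Finset.induction_on with
  | empty => simpa using RedTo.nat 0
  | insert a s ha ih =>
    rw [sum_insert ha, sum_insert ha]
    exact (h a (mem_insert_self _ _)).add (ih fun i hi => h i (mem_insert_of_mem hi))

lemma RedTo.of_mem {x : ℚ} (h : x ∈ SS p) : ∃ c, RedTo p x c := ⟨_, ⟨x, h⟩, rfl, rfl⟩

lemma RedTo.mem {x : ℚ} {c : ZMod p} (h : RedTo p x c) : x ∈ SS p := by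
  obtain ⟨s, rfl, _⟩ := h; exact s.2

lemma RedTo.zero_of_dvd {n : ℕ} (hn : p ∣ n) {x : ℚ} (h : x ∈ SS p) : RedTo p (n * x) 0 := by
  have := (RedTo.nat (p := p) n).mul (RedTo.of_mem h).choose_spec
  rwa [(ZMod.natCast_eq_zero_iff n p).mpr hn, zero_mul] at this

lemma nat_ne_zero {n : ℕ} (h0 : 0 < n) (h : n < p) : (n : ZMod p) ≠ 0 := by
  rw [ne_eq, ZMod.natCast_eq_zero_iff]
  exact Nat.not_dvd_of_pos_of_lt h0 h

lemma bern_mem (i : ℕ) (hi : i + 1 < p) : bernoulli i ∈ SS p := by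
  induction i using Nat.strong_induction_on with
  | _ i ih =>
    have h := sum_bernoulli (i + 1)
    rw [sum_range_succ, Nat.choose_succ_self_right] at h
    have h1 : (∑ x ∈ Finset.range i, ((i+1).choose x : ℚ) * bernoulli x) ∈ SS p :=
      sum_mem fun x hx => mul_mem (natCast_mem _ _)
        (ih x (Finset.mem_range.mp hx) (by have := Finset.mem_range.mp hx; omega))
    have h2 : ((i + 1 : ℕ) : ℚ)⁻¹ ∈ SS p :=
      ((RedTo.nat (p := p) (i+1)).inv (nat_ne_zero (by omega) hi)).mem
    have h3 : (if i + 1 = 1 then (1:ℚ) else 0) ∈ SS p := by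
      split_ifs
      exacts [one_mem _, zero_mem _]
    have h4 : ((i + 1 : ℕ) : ℚ) ≠ 0 := by positivity
    have h5 : bernoulli i = ((i + 1 : ℕ) : ℚ)⁻¹ * ((if i + 1 = 1 then (1:ℚ) else 0) -
      ∑ x ∈ Finset.range i, ((i+1).choose x : ℚ) * bernoulli x) := by
      rw [← h]; field_simp; ring
    rw [h5]
    exact mul_mem h2 (sub_mem h3 h1)

lemma bern_pm1 (hp5 : 5 ≤ p) : RedTo p (p * bernoulli (p - 1)) (-1) := by
  obtain ⟨r, rfl⟩ : ∃ r, p = r + 2 := ⟨p - 2, by omega⟩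
  have h := sum_bernoulli (r + 2)
  rw [sum_range_succ, Nat.choose_succ_self_right, sum_range_succ', if_neg (by omega)] at h
  have h1 := RedTo.sum (p := r + 2) (Finset.range r)
    (fun i => ((r+2).choose (i+1) : ℚ) * bernoulli (i+1)) (fun _ => 0)
    (fun i hi => by
      have := Finset.mem_range.mp hi
      exact RedTo.zero_of_dvd (hpf.out.dvd_choose_self (by omega) (by omega)) (bern_mem _ (by omega)))
  have h2 := (h1.add (RedTo.int 1)).neg
  have er : r + 2 - 1 = r + 1 := by omega
  rw [er]
  convert h2 using 1
  · simp at h ⊢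
    linear_combination h
  · simp

lemma bern_pp1 (hp5 : 5 ≤ p) : RedTo p (bernoulli (p + 1)) (12)⁻¹ := by
  obtain ⟨r, hr⟩ : ∃ r, p = r + 4 := ⟨p - 4, by omega⟩
  have h := sum_bernoulli (p + 2)
  have hodd : Odd p := hpf.out.odd_of_ne_two (by omega)
  rw [sum_range_succ, Nat.choose_succ_self_right, sum_range_succ,
    bernoulli_eq_zero_of_odd hodd (by omega), if_neg (by omega)] at h
  have hm := bern_pm1 hp5
  have hs : Finset.range p = Finset.range (r + 1 + 1 + 1 + 1) := by rw [hr]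
  rw [hs, sum_range_succ, sum_range_succ', sum_range_succ', sum_range_succ'] at h
  have h1 := RedTo.sum (p := p) (Finset.range r)
    (fun i => ((p+2).choose (i+1+1+1) : ℚ) * bernoulli (i+1+1+1)) (fun _ => 0)
    (fun i hi => by
      have := Finset.mem_range.mp hi
      exact RedTo.zero_of_dvd (hpf.out.dvd_choose (by omega) (by omega) (by omega))
        (bern_mem _ (by omega)))
  have n2 : ((2 : ℕ) : ZMod p) ≠ 0 := nat_ne_zero (by norm_num) (by omega)
  have n3 : ((3 : ℕ) : ZMod p) ≠ 0 := nat_ne_zero (by norm_num) (by omega)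
  have hp0 : ((p : ℕ) : ZMod p) = 0 := by simp
  have e1 : p - 1 = r + 1 + 1 + 1 := by omega
  have c2 : ((p+2).choose 2 : ℚ) = (p + 2) * (p + 1) / 2 := by
    rw [Nat.cast_choose_two]; push_cast; ring
  have c3 : ((p+2).choose (r+1+1+1) : ℚ) = (p + 2) * (p + 1) * p / 6 := by
    have : (p+2).choose (r+1+1+1) = (p+2).choose 3 := by
      rw [← Nat.choose_symm (by omega)]; congr 1; omega
    rw [this]
    rw [Nat.cast_choose ℚ (by omega), show p + 2 - 3 = p - 1 by omega, Nat.factorial_succ,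
      Nat.factorial_succ, ← Nat.mul_factorial_pred hpf.out.ne_zero]
    have := Nat.factorial_ne_zero (p-1)
    have h6 : Nat.factorial 3 = 6 := rfl
    rw [h6]
    field_simp
    push_cast
    ring
  have e3 : r + 3 = p - 1 := by omega
  rw [c3, show (0 + 1 + 1) = 2 from rfl, c2, e3] at h
  have hP : RedTo p (p : ℚ) 0 := by simpa using RedTo.nat (p := p) p
  have q1 : RedTo p ((p : ℚ) + 2) 2 := by simpa using hP.add (RedTo.nat 2)
  have q2 : RedTo p ((p : ℚ) + 1) 1 := by simpa using hP.add (RedTo.nat 1)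
  have i2 := (RedTo.nat (p := p) 2).inv n2
  have i3 := (RedTo.nat (p := p) 3).inv n3
  have q1' : RedTo p ((p : ℚ) + 2)⁻¹ 2⁻¹ := q1.inv (by exact_mod_cast n2)
  -- the final formula
  have tot := q1'.mul ((h1.add (((hP.mul i2).neg).add
    ((((((q1.mul q2).mul i2).mul i2).mul i3)).add
      ((((q1.mul q2).mul i2).mul i3).mul hm)))).neg)
  have hne : (p : ℚ) + 2 ≠ 0 := by positivity
  convert tot using 1
  · rw [eq_inv_mul_iff_mul_eq₀ hne]
    simp at h ⊢
    linear_combination h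
  · have n2' : (2 : ZMod p) ≠ 0 := by exact_mod_cast n2
    have n3' : (3 : ZMod p) ≠ 0 := by exact_mod_cast n3
    have : (12 : ZMod p) = 2 * 2 * 3 := by norm_num
    rw [this]
    push_cast
    simp only [sum_const_zero]
    field_simp
    norm_num

lemma EAs_red (hp5 : 5 ≤ p) (n : ℕ) :
    RedTo p ((EAs p).coeff n) ((1 : PowerSeries (ZMod p)).coeff n) := by
  rw [EAs, PowerSeries.coeff_mk, PowerSeries.coeff_one]
  split_ifs with h
  · simpa using RedTo.nat (p := p) 1
  · have hm := (bern_pm1 hp5).inv (by simp)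
    have hP : RedTo p (p : ℚ) 0 := by simpa using RedTo.nat (p := p) p
    have hs : RedTo p (sigmaQ (p-2) n) (ArithmeticFunction.sigma (p-2) n : ℕ) := by
      rw [sigmaQ_eq]; exact RedTo.nat _
    have hp0 : (p : ℚ) ≠ 0 := by exact_mod_cast hpf.out.ne_zero
    have := (((((RedTo.nat (p := p) 2).mul (hP.add (RedTo.int (-1)))).mul hP).mul hm).neg).mul hs
    convert this using 1
    · push_cast
      rw [mul_inv]
      field_simp
      ring
    · simp

lemma EBs_red (hp5 : 5 ≤ p) (n : ℕ) :
    ∃ z : ℤ, E2s.coeff n = z ∧ RedTo p ((EBs p).coeff n) (z : ZMod p) := by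
  rw [EBs, E2s, PowerSeries.coeff_mk, PowerSeries.coeff_mk]
  split_ifs with h
  · exact ⟨1, by simp, by simpa using RedTo.nat (p := p) 1⟩
  · refine ⟨-24 * (ArithmeticFunction.sigma 1 n : ℕ), by rw [sigmaQ_eq]; push_cast; rfl, ?_⟩
    have n2 : ((2 : ℕ) : ZMod p) ≠ 0 := nat_ne_zero (by norm_num) (by omega)
    have n3 : ((3 : ℕ) : ZMod p) ≠ 0 := nat_ne_zero (by norm_num) (by omega)
    have n2' : (2 : ZMod p) ≠ 0 := by exact_mod_cast n2
    have n3' : (3 : ZMod p) ≠ 0 := by exact_mod_cast n3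
    have h12 : (12 : ZMod p) = 2 * 2 * 3 := by norm_num
    have hm := (bern_pp1 hp5).inv (inv_ne_zero (by rw [h12]; simp [n2', n3']))
    have hP : RedTo p (p : ℚ) 0 := by simpa using RedTo.nat (p := p) p
    have hs : RedTo p (sigmaQ p n) (ArithmeticFunction.sigma 1 n : ℕ) := by
      rw [sigmaQ_eq]; convert RedTo.nat (p := p) _ using 1
      simp only [ArithmeticFunction.sigma_apply]
      push_cast
      refine sum_congr rfl fun d _ => ?_
      rw [ZMod.pow_card, pow_one]
    have := (((((RedTo.nat (p := p) 2).mul (hP.add (RedTo.int 1)))).mul hm).neg).mul hs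
    convert this using 1
    · push_cast
      ring
    · push_cast
      rw [inv_inv]
      ring

end Arith

section AlgK

variable {K : Type*} [Field K]

lemma intertw {σ A' : Type*} [CommRing A'] [Algebra K A']
    (D : Derivation K (MvPolynomial σ K) (MvPolynomial σ K)) (D' : Derivation K A' A')
    (φ : MvPolynomial σ K →ₐ[K] A') (h : ∀ i, φ (D (X i)) = D' (φ (X i))) (g : MvPolynomial σ K) :
    φ (D g) = D' (φ g) := by
  induction g using MvPolynomial.induction_on with
  | C a =>
    have h1 : (C a : MvPolynomial σ K) = algebraMap K _ a := rfl
    rw [h1, D.map_algebraMap, AlgHom.commutes, D'.map_algebraMap, map_zero]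
  | add a b ha hb => simp only [map_add, ha, hb]
  | mul_X a i ha =>
    simp only [Derivation.leibniz, map_mul, map_add, smul_eq_mul, ha, h]

lemma der_homog {σ : Type*} (w : σ → ℕ) (e : ℕ) (f : σ → MvPolynomial σ K)
    (hf : ∀ i, IsWeightedHomogeneous w (f i) (w i + e)) {g : MvPolynomial σ K} {n : ℕ}
    (hg : IsWeightedHomogeneous w g n) :
    IsWeightedHomogeneous w (mkDerivation K f g) (n + e) := by
  rw [g.as_sum, map_sum]
  refine IsWeightedHomogeneous.sum _ _ _ fun s hs => ?_
  have hw : Finsupp.weight w s = n := hg (mem_support_iff.mp hs)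
  rw [mkDerivation_monomial]
  rw [← mem_weightedHomogeneousSubmodule]
  refine Submodule.smul_mem _ _ (Submodule.sum_mem _ fun i hi => ?_)
  rw [mem_weightedHomogeneousSubmodule]
  simp only [smul_eq_mul]
  have h1 : Finsupp.weight w (s - Finsupp.single i 1) + w i = n := by
    rw [← hw]; exact Finsupp.weight_sub_single_add (by simpa using hi)
  have h2 := (isWeightedHomogeneous_monomial w (s - Finsupp.single i 1) ((s i : ℕ) : K) rfl).mul (hf i)
  convert h2 using 1
  omega

lemma qexp_aux {v : PowerSeries K} (hv : PowerSeries.constantCoeff v = 1) (hv1 : v ≠ 1)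
    {g : Polynomial K} (hg : Polynomial.aeval v g = 0) : g = 0 := by
  by_contra h0
  obtain ⟨q, hq, hnd⟩ := Polynomial.exists_eq_pow_rootMultiplicity_mul_and_not_dvd g h0 1
  rw [hq, map_mul, map_pow] at hg
  have h1 : Polynomial.aeval v (Polynomial.X - Polynomial.C (1 : K)) ≠ 0 := by
    simpa [sub_eq_zero] using hv1
  have h2 : Polynomial.aeval v q = 0 := (mul_eq_zero.mp hg).resolve_left (pow_ne_zero _ h1)
  apply hnd
  rw [Polynomial.dvd_iff_isRoot, Polynomial.IsRoot.def]
  have h3 := congrArg (PowerSeries.constantCoeff) h2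
  rw [Polynomial.aeval_def, Polynomial.hom_eval₂, hv, map_zero] at h3
  have h4 : (PowerSeries.constantCoeff (R := K)).comp (algebraMap K (PowerSeries K)) = RingHom.id K := by
    ext x; simp
  rw [h4] at h3
  exact h3

lemma wt2 (s : Fin 2 →₀ ℕ) : Finsupp.weight ![4, 6] s = 4 * s 0 + 6 * s 1 := by
  rw [Finsupp.weight_apply, Finsupp.sum_fintype _ _ (by simp)]
  simp [Fin.sum_univ_two]; ring

lemma qexp_principle {e4 e6 : PowerSeries K} (h4 : PowerSeries.constantCoeff e4 = 1)
    (h6 : PowerSeries.constantCoeff e6 = 1) (hne : e4 ^ 3 ≠ e6 ^ 2) {n : ℕ}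
    {f : MvPolynomial (Fin 2) K} (hf : IsWeightedHomogeneous ![4, 6] f n)
    (h0 : aeval ![e4, e6] f = 0) : f = 0 := by
  have h6' : PowerSeries.constantCoeff e6 ≠ 0 := by simp [h6]
  have hi : e6 * e6⁻¹ = 1 := PowerSeries.mul_inv_cancel _ h6'
  set μ := e4 * e6⁻¹ with hμ
  set v := e4 ^ 3 * e6⁻¹ ^ 2 with hvdef
  have a4 : μ ^ 2 * e4 = v := by rw [hμ, hvdef]; ring
  have a6 : μ ^ 3 * e6 = v := by
    rw [hμ, hvdef]
    linear_combination (e4 ^ 3 * e6⁻¹ ^ 2) * hi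
  have hv : PowerSeries.constantCoeff v = 1 := by
    simp [hvdef, h4, h6]
  have hv1 : v ≠ 1 := by
    intro h
    apply hne
    have : v * e6 ^ 2 = e4 ^ 3 := by
      rw [hvdef]; linear_combination (e4 ^ 3) * (e6 * e6⁻¹ + 1) * hi
    rw [h] at this
    rw [← this, one_mul]
  have hw : ∀ s ∈ f.support, 4 * s 0 + 6 * s 1 = n := fun s hs => by
    rw [← wt2]; exact hf (mem_support_iff.mp hs)
  set g : Polynomial K := aeval ![Polynomial.X, Polynomial.X] f with hg
  have e1 : Polynomial.aeval v g = 0 := by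
    have : Polynomial.aeval v g = μ ^ (n / 2) * aeval ![e4, e6] f := by
      rw [hg, aeval_def, eval₂_eq', aeval_def, eval₂_eq', map_sum, mul_sum]
      refine sum_congr rfl fun s hs => ?_
      have : n / 2 = 2 * s 0 + 3 * s 1 := by have := hw s hs; omega
      rw [this, Fin.prod_univ_two, Fin.prod_univ_two]
      simp only [map_mul, map_pow, Matrix.cons_val_zero, Matrix.cons_val_one, Polynomial.aeval_X]
      have b4 : v ^ s 0 = (μ ^ 2 * e4) ^ s 0 := by rw [a4]
      have b6 : v ^ s 1 = (μ ^ 3 * e6) ^ s 1 := by rw [a6]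
      rw [b4, b6]
      simp only [Polynomial.algebraMap_apply, Polynomial.aeval_C, Algebra.algebraMap_self_apply]
      ring
    rw [this, h0, mul_zero]
  have hg0 := qexp_aux hv hv1 e1
  ext s
  rw [coeff_zero]
  by_contra hs
  have hs' : s ∈ f.support := mem_support_iff.mpr hs
  have : g.coeff (s 0 + s 1) = f.coeff s := by
    rw [hg, aeval_def, eval₂_eq', Polynomial.finsetSum_coeff, sum_eq_single s]
    · simp [Fin.prod_univ_two, ← pow_add]
    · intro b hb hbs
      simp only [Fin.prod_univ_two, Matrix.cons_val_zero, Matrix.cons_val_one, ← pow_add, Polynomial.algebraMap_apply,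
        Polynomial.coeff_C_mul_X_pow, Algebra.algebraMap_self_apply]
      rw [if_neg]
      intro h
      apply hbs
      have h1 := hw s hs'
      have h2 := hw b hb
      ext i
      fin_cases i
      · simp; omega
      · simp; omega
    · intro h; exact absurd hs' h
  rw [hg0] at this
  exact hs (by simpa using this.symm)

/-- the theta derivation -/
def thG {R : Type*} [CommRing R] (u v : R) (A B : MvPolynomial (Fin 2) R) :
    Derivation R (MvPolynomial (Fin 2) R) (MvPolynomial (Fin 2) R) :=
  mkDerivation R ![C u * (B * X 0 - A * X 1), C v * (B * X 1 - A * X 0 ^ 2)]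

/-- the universal theta derivation on `K[P,Q,R,Y]` -/
def Dt (K : Type*) [Field K] : Derivation K (MvPolynomial (Fin 4) K) (MvPolynomial (Fin 4) K) :=
  mkDerivation K ![C 12⁻¹ * (X 0 ^ 2 - X 1 * X 3 ^ 2), C 3⁻¹ * (X 0 * X 1 - X 2 * X 3),
    C 2⁻¹ * (X 0 * X 2 - X 1 ^ 2 * X 3), 0]

def Nt (K : Type*) [Field K] : Derivation K (MvPolynomial (Fin 4) K) (MvPolynomial (Fin 4) K) :=
  mkDerivation K ![C 12, 0, 0, 0]

def Wt (K : Type*) [Field K] : Derivation K (MvPolynomial (Fin 4) K) (MvPolynomial (Fin 4) K) :=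
  mkDerivation K ![C 2 * X 0, C 4 * X 1, C 6 * X 2, 0]

lemma four_ne (h2 : (2 : K) ≠ 0) (h3 : (3 : K) ≠ 0) : (12 : K) ≠ 0 := by
  have : (12 : K) = 2 * 2 * 3 := by norm_num
  rw [this]; simp [h2, h3]

lemma comm_ND (h2 : (2 : K) ≠ 0) (h3 : (3 : K) ≠ 0) : ⁅Nt K, Dt K⁆ = Wt K := by
  have h12 := four_ne h2 h3
  have c12 : (12 : MvPolynomial (Fin 4) K) * C 12⁻¹ = 1 := by
    have : (12 : MvPolynomial (Fin 4) K) = C 12 := (map_ofNat C 12).symm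
    rw [this, ← C_mul, mul_inv_cancel₀ h12, C_1]
  have c3 : (3 : MvPolynomial (Fin 4) K) * C 3⁻¹ = 1 := by
    have : (3 : MvPolynomial (Fin 4) K) = C 3 := (map_ofNat C 3).symm
    rw [this, ← C_mul, mul_inv_cancel₀ h3, C_1]
  have c2 : (2 : MvPolynomial (Fin 4) K) * C 2⁻¹ = 1 := by
    have : (2 : MvPolynomial (Fin 4) K) = C 2 := (map_ofNat C 2).symm
    rw [this, ← C_mul, mul_inv_cancel₀ h2, C_1]
  apply MvPolynomial.derivation_ext
  intro i
  rw [Derivation.commutator_apply]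
  have d2 : (C 2 : MvPolynomial (Fin 4) K) = 2 := map_ofNat C 2
  have d4 : (C 4 : MvPolynomial (Fin 4) K) = 4 := map_ofNat C 4
  have d6 : (C 6 : MvPolynomial (Fin 4) K) = 6 := map_ofNat C 6
  have d12 : (C 12 : MvPolynomial (Fin 4) K) = 12 := map_ofNat C 12
  fin_cases i <;> simp [Nt, Dt, Wt, mkDerivation_X, Derivation.leibniz, Derivation.leibniz_pow,
    MvPolynomial.derivation_C]
  all_goals simp only [d2, d4, d6, d12]
  · linear_combination 2 * X 0 * c12
  · linear_combination 4 * X 1 * c3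
  · linear_combination 6 * X 2 * c2

lemma comm_WD : ⁅Wt K, Dt K⁆ = (2 : K) • Dt K := by
  apply MvPolynomial.derivation_ext
  intro i
  rw [Derivation.commutator_apply]
  have d2 : (C 2 : MvPolynomial (Fin 4) K) = 2 := map_ofNat C 2
  have d4 : (C 4 : MvPolynomial (Fin 4) K) = 4 := map_ofNat C 4
  have d6 : (C 6 : MvPolynomial (Fin 4) K) = 6 := map_ofNat C 6
  fin_cases i <;> simp [Dt, Wt, mkDerivation_X, Derivation.leibniz, Derivation.leibniz_pow,
    MvPolynomial.derivation_C, MvPolynomial.smul_eq_C_mul]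
  all_goals simp only [d2, d4, d6]
  all_goals ring

lemma iter_ND (h2 : (2 : K) ≠ 0) (h3 : (3 : K) ≠ 0) (k : ℕ) (F : MvPolynomial (Fin 4) K)
    (hN : Nt K F = 0) (hW : Wt K F = (k : MvPolynomial (Fin 4) K) * F) (m : ℕ) :
    Wt K ((Dt K)^[m] F) = ((k + 2 * m : ℕ) : MvPolynomial (Fin 4) K) * (Dt K)^[m] F ∧
    Nt K ((Dt K)^[m + 1] F) =
      (((m + 1) * (k + m) : ℕ) : MvPolynomial (Fin 4) K) * (Dt K)^[m] F := by
  have cN : ∀ x, Nt K (Dt K x) = Dt K (Nt K x) + Wt K x := fun x => by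
    rw [← comm_ND h2 h3, Derivation.commutator_apply]; ring
  have cW : ∀ x, Wt K (Dt K x) = Dt K (Wt K x) + 2 * Dt K x := fun x => by
    have := congrArg (fun d => d x) (comm_WD (K := K))
    simp only [Derivation.commutator_apply, Derivation.smul_apply, MvPolynomial.smul_eq_C_mul] at this
    rw [sub_eq_iff_eq_add] at this
    rw [this, show (C 2 : MvPolynomial (Fin 4) K) = 2 from map_ofNat C 2]; ring
  have cD : ∀ (j : ℕ) x, Dt K ((j : MvPolynomial (Fin 4) K) * x) = j * Dt K x := fun j x => by
    rw [Derivation.leibniz, Derivation.map_natCast]; simp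
  induction m with
  | zero =>
    refine ⟨by simpa using hW, ?_⟩
    simp only [Function.iterate_succ_apply', Function.iterate_zero, id]
    rw [cN, hN, hW]; simp
  | succ m ih =>
    have w1 : Wt K ((Dt K)^[m+1] F) = ((k + 2 * (m+1) : ℕ) : MvPolynomial (Fin 4) K) * (Dt K)^[m+1] F := by
      rw [Function.iterate_succ_apply', cW, ih.1, cD]; push_cast; ring
    refine ⟨w1, ?_⟩
    rw [Function.iterate_succ_apply', cN, ih.2, w1, cD, ← Function.iterate_succ_apply' (Dt K)]
    push_cast; ring

lemma wt4 (s : Fin 4 →₀ ℕ) : Finsupp.weight ![1, 0, 0, 1] s = s 0 + s 3 := by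
  rw [Finsupp.weight_apply, Finsupp.sum_fintype _ _ (by simp)]
  simp [Fin.sum_univ_four]

lemma Dt_homog {g : MvPolynomial (Fin 4) K} {n : ℕ} (hg : IsWeightedHomogeneous ![1,0,0,1] g n) :
    IsWeightedHomogeneous ![1,0,0,1] (Dt K g) (n + 1) := by
  refine der_homog _ 1 _ (fun i => ?_) hg
  have hX := fun i : Fin 4 => isWeightedHomogeneous_X K (![1,0,0,1] : Fin 4 → ℕ) i
  have hC := fun a : K => isWeightedHomogeneous_C (![1,0,0,1] : Fin 4 → ℕ) a
  fin_cases i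
  · exact (hC _).mul (((hX 0).pow 2).sub ((hX 1).mul ((hX 3).pow 2)))
  · exact (hC _).mul (((hX 0).mul (hX 1)).sub ((hX 2).mul (hX 3)))
  · exact (hC _).mul (((hX 0).mul (hX 2)).sub (((hX 1).pow 2).mul (hX 3)))
  · exact isWeightedHomogeneous_zero _ _ _

end AlgK

section AlgK2

variable {K : Type*} [Field K]

/-- the qd/dq derivation on power series -/
def qd (K : Type*) [Field K] : Derivation K (PowerSeries K) (PowerSeries K) :=
  (PowerSeries.X : PowerSeries K) • PowerSeries.derivative K

lemma qd_apply (f : PowerSeries K) : qd K f = PowerSeries.X * PowerSeries.derivative K f := rfl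

lemma thG_homog {u v : K} {A B : MvPolynomial (Fin 2) K} {a : ℕ}
    (hA : IsWeightedHomogeneous ![4, 6] A a) (hB : IsWeightedHomogeneous ![4, 6] B (a + 2))
    {g : MvPolynomial (Fin 2) K} {n : ℕ} (hg : IsWeightedHomogeneous ![4,6] g n) :
    IsWeightedHomogeneous ![4,6] (thG u v A B g) (n + (a + 2)) := by
  refine der_homog _ _ _ (fun i => ?_) hg
  have hX := fun i : Fin 2 => isWeightedHomogeneous_X K (![4,6] : Fin 2 → ℕ) i
  have hC := fun a : K => isWeightedHomogeneous_C (![4,6] : Fin 2 → ℕ) a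
  have cast : ∀ {f : MvPolynomial (Fin 2) K} {x y : ℕ}, IsWeightedHomogeneous ![4,6] f x → x = y →
    IsWeightedHomogeneous ![4,6] f y := fun h e => e ▸ h
  fin_cases i
  · refine cast ((hC _).mul ((cast (hB.mul (hX 0)) ?_).sub (hA.mul (hX 1)))) ?_
    · simp
    · simp; ring
  · refine cast ((hC _).mul ((cast (hB.mul (hX 1)) ?_).sub (hA.mul ((hX 0).pow 2)))) ?_
    · simp
    · simp; ring

lemma thG_qd {A B : MvPolynomial (Fin 2) K} {e2 e4 e6 : PowerSeries K} {u v : K}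
    (hA : aeval ![e4, e6] A = 1) (hB : aeval ![e4, e6] B = e2)
    (r4 : qd K e4 = PowerSeries.C u * (e2 * e4 - e6))
    (r6 : qd K e6 = PowerSeries.C v * (e2 * e6 - e4 ^ 2)) (g : MvPolynomial (Fin 2) K) :
    aeval ![e4, e6] (thG u v A B g) = qd K (aeval ![e4, e6] g) := by
  apply intertw
  intro i
  fin_cases i
  · simp [thG, mkDerivation_X, hA, hB, r4, ← PowerSeries.algebraMap_eq]
  · simp [thG, mkDerivation_X, hA, hB, r6, ← PowerSeries.algebraMap_eq]

lemma thA_zero {A B : MvPolynomial (Fin 2) K} {e2 e4 e6 : PowerSeries K} {u v : K} {a : ℕ}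
    (hAh : IsWeightedHomogeneous ![4, 6] A a) (hBh : IsWeightedHomogeneous ![4, 6] B (a + 2))
    (h4 : PowerSeries.constantCoeff e4 = 1)
    (h6 : PowerSeries.constantCoeff e6 = 1) (hne : e4 ^ 3 ≠ e6 ^ 2)
    (hA : aeval ![e4, e6] A = 1) (hB : aeval ![e4, e6] B = e2)
    (r4 : qd K e4 = PowerSeries.C u * (e2 * e4 - e6))
    (r6 : qd K e6 = PowerSeries.C v * (e2 * e6 - e4 ^ 2)) : thG u v A B A = 0 := by
  refine qexp_principle h4 h6 hne (thG_homog hAh hBh hAh) ?_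
  rw [thG_qd hA hB r4 r6, hA, Derivation.map_one_eq_zero]

lemma thB_eq {A B : MvPolynomial (Fin 2) K} {e2 e4 e6 : PowerSeries K} {u v w : K} {a : ℕ}
    (hAh : IsWeightedHomogeneous ![4, 6] A a) (hBh : IsWeightedHomogeneous ![4, 6] B (a + 2))
    (h4 : PowerSeries.constantCoeff e4 = 1)
    (h6 : PowerSeries.constantCoeff e6 = 1) (hne : e4 ^ 3 ≠ e6 ^ 2)
    (hA : aeval ![e4, e6] A = 1) (hB : aeval ![e4, e6] B = e2)
    (r2 : qd K e2 = PowerSeries.C w * (e2 ^ 2 - e4))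
    (r4 : qd K e4 = PowerSeries.C u * (e2 * e4 - e6))
    (r6 : qd K e6 = PowerSeries.C v * (e2 * e6 - e4 ^ 2)) :
    thG u v A B B = C w * (B ^ 2 - X 0 * A ^ 2) := by
  rw [← sub_eq_zero]
  have hX := fun i : Fin 2 => isWeightedHomogeneous_X K (![4,6] : Fin 2 → ℕ) i
  have hC := fun a : K => isWeightedHomogeneous_C (![4,6] : Fin 2 → ℕ) a
  have cast : ∀ {f : MvPolynomial (Fin 2) K} {x y : ℕ}, IsWeightedHomogeneous ![4,6] f x → x = y →
    IsWeightedHomogeneous ![4,6] f y := fun h e => e ▸ h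
  refine qexp_principle h4 h6 hne ((thG_homog hAh hBh hBh).sub (cast ((hC _).mul
    ((hBh.pow 2).sub (cast ((hX 0).mul (hAh.pow 2)) ?_))) ?_)) ?_
  · simp; ring
  · simp; ring
  · rw [map_sub, thG_qd hA hB r4 r6, hB, r2]
    simp [hA, hB, ← PowerSeries.algebraMap_eq]

/-- the evaluation P -> B, Y -> A -/
def evG (A B : MvPolynomial (Fin 2) K) : MvPolynomial (Fin 4) K →ₐ[K] MvPolynomial (Fin 2) K :=
  aeval ![B, X 0, X 1, A]

lemma evG_Dt {A B : MvPolynomial (Fin 2) K} (hA : thG 3⁻¹ 2⁻¹ A B A = 0)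
    (hB : thG 3⁻¹ 2⁻¹ A B B = C 12⁻¹ * (B ^ 2 - X 0 * A ^ 2)) (g : MvPolynomial (Fin 4) K) :
    evG A B (Dt K g) = thG 3⁻¹ 2⁻¹ A B (evG A B g) := by
  apply intertw
  intro i
  fin_cases i
  · simp [evG, Dt, mkDerivation_X, hB, MvPolynomial.algebraMap_eq]
  · simp [evG, Dt, thG, mkDerivation_X, MvPolynomial.algebraMap_eq]; left; ring
  · simp [evG, Dt, thG, mkDerivation_X, MvPolynomial.algebraMap_eq]; left; ring
  · simp [evG, Dt, mkDerivation_X, hA]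

/-- the inclusion -/
def inc : MvPolynomial (Fin 2) K →ₐ[K] MvPolynomial (Fin 4) K := aeval ![X 1, X 2]

lemma evG_inc (A B F : MvPolynomial (Fin 2) K) : evG A B (inc F) = F := by
  have : (evG A B).comp inc = AlgHom.id K _ := by
    apply MvPolynomial.algHom_ext
    intro i
    fin_cases i <;> simp [evG, inc]
  exact DFunLike.congr_fun this F

lemma Nt_inc (F : MvPolynomial (Fin 2) K) : Nt K (inc F) = 0 := by
  rw [← intertw (0 : Derivation K (MvPolynomial (Fin 2) K) (MvPolynomial (Fin 2) K)) (Nt K) inc]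
  · simp
  · intro i
    fin_cases i <;> simp [inc, Nt, mkDerivation_X]

lemma Wt_inc {F : MvPolynomial (Fin 2) K} {k : ℕ} (hF : IsWeightedHomogeneous ![4, 6] F k) :
    Wt K (inc F) = (k : MvPolynomial (Fin 4) K) * inc F := by
  rw [← intertw (mkDerivation K ![C 4 * X 0, C 6 * X 1]) (Wt K) inc]
  · have h := hF.sum_weight_X_mul_pderiv
    have e : mkDerivation K ![C 4 * X 0, C 6 * X 1] =
        ((C 4 * X 0 : MvPolynomial (Fin 2) K)) • (pderiv 0 : Derivation K (MvPolynomial (Fin 2) K) (MvPolynomial (Fin 2) K))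
         + ((C 6 * X 1 : MvPolynomial (Fin 2) K)) • (pderiv 1) := by
      apply MvPolynomial.derivation_ext
      intro i
      fin_cases i <;> simp [mkDerivation_X, pderiv_X]
    have d4 : (C 4 : MvPolynomial (Fin 2) K) = 4 := map_ofNat C 4
    have d6 : (C 6 : MvPolynomial (Fin 2) K) = 6 := map_ofNat C 6
    have : mkDerivation K ![C 4 * X 0, C 6 * X 1] F = (k : MvPolynomial (Fin 2) K) * F := by
      rw [e]
      simp [Fin.sum_univ_two] at h
      simp [d4, d6]
      linear_combination h
    rw [this, map_mul, map_natCast]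
  · intro i
    fin_cases i <;> simp [inc, Wt, mkDerivation_X, MvPolynomial.algebraMap_eq]

lemma inc_homog (F : MvPolynomial (Fin 2) K) : IsWeightedHomogeneous ![1,0,0,1] (inc F : MvPolynomial (Fin 4) K) 0 := by
  have hX := fun i : Fin 4 => isWeightedHomogeneous_X K (![1,0,0,1] : Fin 4 → ℕ) i
  have hC := fun a : K => isWeightedHomogeneous_C (![1,0,0,1] : Fin 4 → ℕ) a
  induction F using MvPolynomial.induction_on with
  | C a => simpa [inc, MvPolynomial.algebraMap_eq] using hC a
  | add a b ha hb => rw [map_add]; exact ha.add hb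
  | mul_X a i ha =>
    rw [map_mul]
    refine ha.mul (n := 0) ?_
    fin_cases i
    · simpa [inc] using hX 1
    · simpa [inc] using hX 2

theorem main_alg (p : ℕ) [CharP K p] (hp5 : 5 ≤ p) (hp : p.Prime)
    {A B F : MvPolynomial (Fin 2) K} (hA : thG 3⁻¹ 2⁻¹ A B A = 0)
    (hB : thG 3⁻¹ 2⁻¹ A B B = C 12⁻¹ * (B ^ 2 - X 0 * A ^ 2)) {k n m : ℕ}
    (hF : IsWeightedHomogeneous ![4, 6] F k) (hm : m + k = n * p + 1) (hmp : m < p) :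
    A ^ m ∣ (thG 3⁻¹ 2⁻¹ A B)^[m] F := by
  have nz : ∀ j : ℕ, 0 < j → j < p → (j : K) ≠ 0 := fun j h0 h1 h => by
    rw [CharP.cast_eq_zero_iff K p] at h
    exact Nat.not_dvd_of_pos_of_lt h0 h1 h
  have h2 : (2 : K) ≠ 0 := by exact_mod_cast nz 2 (by norm_num) (by omega)
  have h3 : (3 : K) ≠ 0 := by exact_mod_cast nz 3 (by norm_num) (by omega)
  have h12 := four_ne h2 h3
  rcases m with _ | m
  · simp
  set G := (Dt K)^[m + 1] (inc F) with hG
  have hN : Nt K G = 0 := by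
    rw [hG, (iter_ND h2 h3 k _ (Nt_inc F) (Wt_inc hF) m).2]
    have : k + m = n * p := by omega
    rw [this]
    have : (((m + 1) * (n * p) : ℕ) : K) = 0 := by simp
    rw [← map_natCast (C : K →+* _), this, map_zero, zero_mul]
  have hH : IsWeightedHomogeneous ![1,0,0,1] G (m + 1) := by
    have : ∀ j, IsWeightedHomogeneous ![1,0,0,1] ((Dt K)^[j] (inc F)) j := fun j => by
      induction j with
      | zero => exact inc_homog F
      | succ j ih => rw [Function.iterate_succ_apply']; exact Dt_homog ih
    exact this _
  have hP : pderiv 0 G = 0 := by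
    have e : Nt K = (C 12 : MvPolynomial (Fin 4) K) • (pderiv 0 : Derivation K (MvPolynomial (Fin 4) K) (MvPolynomial (Fin 4) K)) := by
      apply MvPolynomial.derivation_ext
      intro i
      fin_cases i <;> simp [Nt, mkDerivation_X, pderiv_X]
    rw [e, Derivation.smul_apply, smul_eq_mul, mul_eq_zero] at hN
    exact hN.resolve_left (by simpa using h12)
  have hsup : ∀ s ∈ G.support, s 0 = 0 ∧ s 3 = m + 1 := by
    intro s hs
    have w : s 0 + s 3 = m + 1 := by rw [← wt4]; exact hH (mem_support_iff.mp hs)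
    have s0 : s 0 = 0 := by
      by_contra h0
      have hc := congrArg (coeff (s - Finsupp.single 0 1)) hP
      rw [coeff_pderiv, coeff_zero] at hc
      have : s - Finsupp.single 0 1 + Finsupp.single 0 1 = s :=
        tsub_add_cancel_of_le (by simpa [Finsupp.single_le_iff] using Nat.one_le_iff_ne_zero.mpr h0)
      rw [this] at hc
      rcases mul_eq_zero.mp hc with h | h
      · exact mem_support_iff.mp hs h
      · have e : ((s - Finsupp.single 0 1 : Fin 4 →₀ ℕ) 0 + 1 : ℕ) = s 0 := by simp; omega
        have : ((s 0 : ℕ) : K) = 0 := by rw [← e]; push_cast; exact h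
        exact nz _ (Nat.pos_of_ne_zero h0) (by omega) this
    exact ⟨s0, by omega⟩
  have hdvd : (X 3 : MvPolynomial (Fin 4) K) ^ (m + 1) ∣ G := by
    rw [G.as_sum]
    refine Finset.dvd_sum fun s hs => ?_
    refine ⟨monomial (s - Finsupp.single 3 (m+1)) (coeff s G), ?_⟩
    rw [X_pow_eq_monomial, monomial_mul, one_mul, add_comm, tsub_add_cancel_of_le]
    rw [Finsupp.single_le_iff, (hsup s hs).2]
  have hev : evG A B G = (thG 3⁻¹ 2⁻¹ A B)^[m + 1] F := by
    have : ∀ j, evG A B ((Dt K)^[j] (inc F)) = (thG 3⁻¹ 2⁻¹ A B)^[j] F := fun j => by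
      induction j with
      | zero => exact evG_inc A B F
      | succ j ih => rw [Function.iterate_succ_apply', Function.iterate_succ_apply', evG_Dt hA hB, ih]
    exact this _
  rw [← hev]
  have := map_dvd (evG A B) hdvd
  simpa [evG] using this

end AlgK2

section Glue

lemma intertw' {σ R R' A' : Type*} [CommRing R] [CommRing R'] [CommRing A'] [Algebra R' A']
    (D : Derivation R (MvPolynomial σ R) (MvPolynomial σ R)) (D' : Derivation R' A' A')
    (φ : MvPolynomial σ R →+* A') (ψ : R → R') (hC : ∀ a, φ (C a) = algebraMap R' A' (ψ a))
    (h : ∀ i, φ (D (X i)) = D' (φ (X i))) (g : MvPolynomial σ R) :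
    φ (D g) = D' (φ g) := by
  induction g using MvPolynomial.induction_on with
  | C a => rw [MvPolynomial.derivation_C, hC, D'.map_algebraMap, map_zero]
  | add a b ha hb => simp only [map_add, ha, hb]
  | mul_X a i ha =>
    simp only [Derivation.leibniz, map_mul, map_add, smul_eq_mul, ha, h]

def e2Z : PowerSeries ℤ :=
  PowerSeries.mk fun n => if n = 0 then 1 else -24 * (ArithmeticFunction.sigma 1 n : ℕ)
def e4Z : PowerSeries ℤ :=
  PowerSeries.mk fun n => if n = 0 then 1 else 240 * (ArithmeticFunction.sigma 3 n : ℕ)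
def e6Z : PowerSeries ℤ :=
  PowerSeries.mk fun n => if n = 0 then 1 else -504 * (ArithmeticFunction.sigma 5 n : ℕ)

/-- base change of an integral power series -/
abbrev bc (R : Type*) [CommRing R] : PowerSeries ℤ →+* PowerSeries R :=
  PowerSeries.map (Int.castRingHom R)

lemma e2Q : bc ℚ e2Z = E2s := by
  ext n
  simp only [bc, e2Z, E2s, PowerSeries.coeff_map, PowerSeries.coeff_mk, sigmaQ_eq]
  split_ifs <;> simp
lemma e4Q : bc ℚ e4Z = E4s := by
  ext n
  simp only [bc, e4Z, E4s, PowerSeries.coeff_map, PowerSeries.coeff_mk, sigmaQ_eq]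
  split_ifs <;> simp
lemma e6Q : bc ℚ e6Z = E6s := by
  ext n
  simp only [bc, e6Z, E6s, PowerSeries.coeff_map, PowerSeries.coeff_mk, sigmaQ_eq]
  split_ifs <;> simp

lemma bc_inj : Function.Injective (bc ℚ) :=
  PowerSeries.map_injective _ Int.cast_injective

lemma bc_deriv (R : Type*) [CommRing R] (f : PowerSeries ℤ) :
    bc R (PowerSeries.derivative ℤ f) = PowerSeries.derivative R (bc R f) := by
  ext n
  simp [PowerSeries.coeff_derivative]

lemma ram2Z : 12 * (PowerSeries.X * PowerSeries.derivative ℤ e2Z) = e2Z ^ 2 - e4Z := by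
  apply bc_inj
  simp only [map_mul, map_sub, map_pow, bc_deriv, e2Q, e4Q, map_ofNat, PowerSeries.map_X]
  rw [ram2, PowerSeries.smul_eq_C_mul]
  have : (12 : PowerSeries ℚ) * PowerSeries.C (1/12) = 1 := by
    rw [← map_ofNat (PowerSeries.C (R := ℚ)) 12, ← map_mul]; norm_num
  linear_combination (E2s * E2s - E4s) * this

lemma ram4Z : 3 * (PowerSeries.X * PowerSeries.derivative ℤ e4Z) = e2Z * e4Z - e6Z := by
  apply bc_inj
  simp only [map_mul, map_sub, bc_deriv, e2Q, e4Q, e6Q, map_ofNat, PowerSeries.map_X]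
  rw [ram4, PowerSeries.smul_eq_C_mul]
  have : (3 : PowerSeries ℚ) * PowerSeries.C (1/3) = 1 := by
    rw [← map_ofNat (PowerSeries.C (R := ℚ)) 3, ← map_mul]; norm_num
  linear_combination (E2s * E4s - E6s) * this

lemma ram6Z : 2 * (PowerSeries.X * PowerSeries.derivative ℤ e6Z) = e2Z * e6Z - e4Z ^ 2 := by
  apply bc_inj
  simp only [map_mul, map_sub, map_pow, bc_deriv, e2Q, e4Q, e6Q, map_ofNat, PowerSeries.map_X]
  rw [ram6, PowerSeries.smul_eq_C_mul]
  have : (2 : PowerSeries ℚ) * PowerSeries.C (1/2) = 1 := by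
    rw [← map_ofNat (PowerSeries.C (R := ℚ)) 2, ← map_mul]; norm_num
  linear_combination (E2s * E6s - E4s * E4s) * this

section
variable (K : Type*) [Field K]

lemma qd_of (n : ℕ) [n.AtLeastTwo] (hn : (OfNat.ofNat n : K) ≠ 0) (f g : PowerSeries ℤ)
    (h : OfNat.ofNat n * (PowerSeries.X * PowerSeries.derivative ℤ f) = g) :
    qd K (bc K f) = PowerSeries.C (OfNat.ofNat n : K)⁻¹ * bc K g := by
  rw [← h, map_mul, map_mul, bc_deriv, PowerSeries.map_X, map_ofNat, qd_apply, ← mul_assoc]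
  rw [← map_ofNat (PowerSeries.C (R := K)) n, ← map_mul, inv_mul_cancel₀ hn, map_one, one_mul]

lemma e4K_c : PowerSeries.constantCoeff (bc K e4Z) = 1 := by
  rw [← PowerSeries.coeff_zero_eq_constantCoeff_apply]
  simp [e4Z]
lemma e6K_c : PowerSeries.constantCoeff (bc K e6Z) = 1 := by
  rw [← PowerSeries.coeff_zero_eq_constantCoeff_apply]
  simp [e6Z]
lemma e46_ne (h2 : (2 : K) ≠ 0) (h3 : (3 : K) ≠ 0) : (bc K e4Z) ^ 3 ≠ (bc K e6Z) ^ 2 := by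
  intro h
  rw [← map_pow, ← map_pow] at h
  have h1 := congrArg (PowerSeries.coeff 1) h
  have a : PowerSeries.coeff 1 (e4Z ^ 3) = 720 := by
    rw [pow_succ, pow_two]
    simp [PowerSeries.coeff_mul, Finset.Nat.antidiagonal_succ, e4Z]
  have b : PowerSeries.coeff 1 (e6Z ^ 2) = -1008 := by
    rw [pow_two]
    simp [PowerSeries.coeff_mul, Finset.Nat.antidiagonal_succ, e6Z]
  rw [bc, PowerSeries.coeff_map, PowerSeries.coeff_map, a, b] at h1
  have : (2 : K) ^ 6 * 3 ^ 3 = 0 := by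
    simp at h1
    linear_combination h1
  simp [h2, h3] at this
end

variable (p : ℕ) [hpf : Fact p.Prime]

/-- embedding of `S[Q,R]` in `ℚ[P,Q,R]` -/
def iot : MvPolynomial (Fin 2) (SS p) →+* Poly3 :=
  (MvPolynomial.map (SS p).subtype).comp (rename ![1, 2]).toRingHom

/-- reduction -/
def rho : MvPolynomial (Fin 2) (SS p) →+* MvPolynomial (Fin 2) (ZMod p) := MvPolynomial.map (red p)

lemma iot_C (a : SS p) : iot p (C a) = C (a : ℚ) := by simp [iot]
lemma iot_X0 : iot p (X 0) = X 1 := by simp [iot]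
lemma iot_X1 : iot p (X 1) = X 2 := by simp [iot]

lemma iot_int (g : MvPolynomial (Fin 2) (SS p)) : polyPInt p (iot p g) := by
  intro m
  rw [← mem_SS_iff]
  simp [iot, coeff_map]

/-- theta as a derivation -/
def thD (A B : Poly3) : Derivation ℚ Poly3 Poly3 :=
  (C (1/3 : ℚ) * (B * X 1 - A * X 2)) • pderiv 1 + (C (1/2 : ℚ) * (B * X 2 - A * X 1 ^ 2)) • pderiv 2

lemma thD_eq (A B f : Poly3) : thetaOp A B f = thD A B f := rfl

lemma iot_th (u v : SS p) (hu : (u : ℚ) = 1/3) (hv : (v : ℚ) = 1/2)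
    (A B g : MvPolynomial (Fin 2) (SS p)) :
    iot p (thG u v A B g) = thetaOp (iot p A) (iot p B) (iot p g) := by
  rw [thD_eq]
  refine intertw' _ _ _ (fun a : SS p => (a : ℚ)) (fun a => iot_C p a) (fun i => ?_) g
  fin_cases i
  · simp [thG, thD, mkDerivation_X, iot_X0, iot_X1, iot_C, hu, pderiv_X]
  · simp [thG, thD, mkDerivation_X, iot_X0, iot_X1, iot_C, hv, pderiv_X]

lemma rho_th (u v : SS p) (A B g : MvPolynomial (Fin 2) (SS p)) :
    rho p (thG u v A B g) = thG (red p u) (red p v) (rho p A) (rho p B) (rho p g) := by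
  refine intertw' _ _ _ (red p) (fun a => by simp [rho, MvPolynomial.algebraMap_eq]) (fun i => ?_) g
  fin_cases i
  · simp [thG, mkDerivation_X, rho]
  · simp [thG, mkDerivation_X, rho]

lemma Phi_iot (g : MvPolynomial (Fin 2) (SS p)) :
    Phi (iot p g) = PowerSeries.map (SS p).subtype (aeval ![bc (SS p) e4Z, bc (SS p) e6Z] g) := by
  have hb : ∀ f, PowerSeries.map (SS p).subtype (bc (SS p) f) = bc ℚ f := fun f => by ext n; simp
  have : (Phi.toRingHom).comp (iot p) = (PowerSeries.map (SS p).subtype).comp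
      (aeval ![bc (SS p) e4Z, bc (SS p) e6Z] : MvPolynomial (Fin 2) (SS p) →ₐ[SS p] _).toRingHom := by
    apply MvPolynomial.ringHom_ext
    · intro r
      simp [iot_C, Phi, PowerSeries.algebraMap_eq]
    · intro i
      fin_cases i
      · simp [iot_X0, Phi, hb, e4Q]
      · simp [iot_X1, Phi, hb, e6Q]
  exact DFunLike.congr_fun this g

lemma aeval_rho (g : MvPolynomial (Fin 2) (SS p)) :
    aeval ![bc (ZMod p) e4Z, bc (ZMod p) e6Z] (rho p g) =
      PowerSeries.map (red p) (aeval ![bc (SS p) e4Z, bc (SS p) e6Z] g) := by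
  have hb : ∀ f, PowerSeries.map (red p) (bc (SS p) f) = bc (ZMod p) f := fun f => by ext n; simp
  have : (aeval ![bc (ZMod p) e4Z, bc (ZMod p) e6Z] :
      MvPolynomial (Fin 2) (ZMod p) →ₐ[ZMod p] _).toRingHom.comp (rho p) =
      (PowerSeries.map (red p)).comp
      (aeval ![bc (SS p) e4Z, bc (SS p) e6Z] : MvPolynomial (Fin 2) (SS p) →ₐ[SS p] _).toRingHom := by
    apply MvPolynomial.ringHom_ext
    · intro r
      simp [rho, PowerSeries.algebraMap_eq]
    · intro i
      fin_cases i
      · simp [rho, hb]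
      · simp [rho, hb]
  exact DFunLike.congr_fun this g

lemma aeval_rho_eq {g : MvPolynomial (Fin 2) (SS p)} {E : PowerSeries ℚ} {e : PowerSeries (ZMod p)}
    (hE : Phi (iot p g) = E) (h : ∀ n, RedTo p (E.coeff n) (e.coeff n)) :
    aeval ![bc (ZMod p) e4Z, bc (ZMod p) e6Z] (rho p g) = e := by
  rw [aeval_rho]
  ext n
  obtain ⟨s, hs, hs'⟩ := h n
  rw [← hE, Phi_iot, PowerSeries.coeff_map] at hs
  have := Subtype.ext (p := (· ∈ SS p)) hs
  rw [PowerSeries.coeff_map, ← hs', this]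

lemma lift_poly {f : Poly3} {k : ℕ} (h1 : Isobaric k f) (h2 : NoP f) (h3 : polyPInt p f) :
    ∃ g : MvPolynomial (Fin 2) (SS p), iot p g = f ∧ IsWeightedHomogeneous ![4, 6] g k := by
  refine ⟨∑ m ∈ f.support, monomial (Finsupp.single 0 (m 1) + Finsupp.single 1 (m 2))
    ⟨coeff m f, (mem_SS_iff p _).mpr (h3 m)⟩, ?_, ?_⟩
  · rw [map_sum]
    conv_rhs => rw [f.as_sum]
    refine sum_congr rfl fun m hm => ?_
    simp only [iot, RingHom.comp_apply, AlgHom.toRingHom_eq_coe, RingHom.coe_coe, rename_monomial,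
      map_monomial]
    have h0 := h2 m hm
    have hs : (Finsupp.single 1 (m 1) + Finsupp.single 2 (m 2) : Fin 3 →₀ ℕ) = m := by
      ext i
      fin_cases i <;> simp [h0]
    rw [Finsupp.mapDomain_add, Finsupp.mapDomain_single, Finsupp.mapDomain_single]
    exact congrArg (fun t => monomial t (coeff m f)) hs
  · refine IsWeightedHomogeneous.sum _ _ _ fun m hm => ?_
    apply isWeightedHomogeneous_monomial
    rw [wt2]
    have := h1 m hm
    have h0 := h2 m hm
    simp
    omega

lemma rho_homog {g : MvPolynomial (Fin 2) (SS p)} {k : ℕ} (h : IsWeightedHomogeneous ![4, 6] g k) :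
    IsWeightedHomogeneous ![4, 6] (rho p g) k := by
  intro m hm
  apply h
  intro h0
  apply hm
  simp [rho, coeff_map, h0]

lemma rho_surj : Function.Surjective (rho p) :=
  MvPolynomial.map_surjective _ (ZMod.ringHom_surjective (red p))

lemma rho_ker {g : MvPolynomial (Fin 2) (SS p)} (h : rho p g = 0) :
    ∃ H, g = (p : MvPolynomial (Fin 2) (SS p)) * H := by
  have : C (p : SS p) ∣ g := by
    rw [MvPolynomial.C_dvd_iff_dvd_coeff]
    intro m
    have := congrArg (coeff m) h
    rw [rho, coeff_map, coeff_zero] at this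
    exact red_eq_zero p this
  rwa [map_natCast] at this

end Glue

theorem stmt_7 (p : ℕ) (hp : p.Prime) (hp5 : 5 ≤ p)
    (A : Poly3) (hAiso : Isobaric (p - 1) A) (hAnoP : NoP A)
    (hAint : polyPInt p A) (hAPhi : Phi A = EAs p)
    (B : Poly3) (hBiso : Isobaric (p + 1) B) (hBnoP : NoP B)
    (hBint : polyPInt p B) (hBPhi : Phi B = EBs p)
    (k : ℕ) (hk : 0 < k) (F : Poly3) (hFiso : Isobaric k F) (hFnoP : NoP F)
    (hFint : polyPInt p F)
    (n : ℕ) (hn1 : (k : ℤ) ≤ n * p + 1) (hn2 : (n * p + 1 : ℤ) - k < p) :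
    ∃ G H : Poly3, polyPInt p G ∧ polyPInt p H ∧
      (thetaOp A B)^[n * p + 1 - k] F = A ^ (n * p + 1 - k) * G + (p : Poly3) * H := by
  have : Fact p.Prime := ⟨hp⟩
  have hkn : k ≤ n * p + 1 := by exact_mod_cast hn1
  have hm : (n * p + 1 - k) + k = n * p + 1 := Nat.sub_add_cancel hkn
  have hmp : n * p + 1 - k < p := by zify [hkn]; exact hn2
  generalize n * p + 1 - k = m at hm hmp ⊢
  obtain ⟨A', rfl, hA'⟩ := lift_poly p hAiso hAnoP hAint
  obtain ⟨B', rfl, hB'⟩ := lift_poly p hBiso hBnoP hBint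
  obtain ⟨F', rfl, hF'⟩ := lift_poly p hFiso hFnoP hFint
  have n2 : ((2 : ℕ) : ZMod p) ≠ 0 := nat_ne_zero (by norm_num) (by omega)
  have n3 : ((3 : ℕ) : ZMod p) ≠ 0 := nat_ne_zero (by norm_num) (by omega)
  have h2 : (2 : ZMod p) ≠ 0 := by exact_mod_cast n2
  have h3 : (3 : ZMod p) ≠ 0 := by exact_mod_cast n3
  have h12 := four_ne h2 h3
  obtain ⟨u, hu, hu'⟩ := (RedTo.nat (p := p) 3).inv n3
  obtain ⟨v, hv, hv'⟩ := (RedTo.nat (p := p) 2).inv n2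
  have pA := aeval_rho_eq p hAPhi (EAs_red hp5)
  have pB : aeval ![bc (ZMod p) e4Z, bc (ZMod p) e6Z] (rho p B') = bc (ZMod p) e2Z := by
    refine aeval_rho_eq p hBPhi fun j => ?_
    obtain ⟨z, hz, hz'⟩ := EBs_red hp5 j
    rw [← e2Q, PowerSeries.coeff_map] at hz
    have : e2Z.coeff j = z := by
      rw [eq_intCast] at hz
      exact_mod_cast hz
    rw [PowerSeries.coeff_map, this]
    exact hz'
  have r2 := qd_of (ZMod p) 12 h12 _ _ ram2Z
  have r4 := qd_of (ZMod p) 3 h3 _ _ ram4Z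
  have r6 := qd_of (ZMod p) 2 h2 _ _ ram6Z
  simp only [map_sub, map_mul, map_pow] at r2 r4 r6
  have c4 := e4K_c (ZMod p)
  have c6 := e6K_c (ZMod p)
  have hne := e46_ne (ZMod p) h2 h3
  have hAh := rho_homog p hA'
  have hBh : IsWeightedHomogeneous ![4, 6] (rho p B') (p - 1 + 2) := by
    have := rho_homog p hB'
    rwa [show p + 1 = p - 1 + 2 by omega] at this
  have tA := thA_zero hAh hBh c4 c6 hne pA pB r4 r6
  have tB := thB_eq hAh hBh c4 c6 hne pA pB r2 r4 r6
  obtain ⟨GK, hGK⟩ := main_alg p hp5 hp tA tB (rho_homog p hF') hm hmp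
  obtain ⟨G, hG⟩ := rho_surj p GK
  have itr : ∀ j, rho p ((thG u v A' B')^[j] F') =
      (thG 3⁻¹ 2⁻¹ (rho p A') (rho p B'))^[j] (rho p F') := fun j => by
    induction j with
    | zero => rfl
    | succ j ih =>
      rw [Function.iterate_succ_apply', Function.iterate_succ_apply', rho_th, ih, hu', hv']
      norm_cast
  have iti : ∀ j, iot p ((thG u v A' B')^[j] F') =
      (thetaOp (iot p A') (iot p B'))^[j] (iot p F') := fun j => by
    induction j with
    | zero => rfl
    | succ j ih =>
      rw [Function.iterate_succ_apply', Function.iterate_succ_apply', iot_th, ih]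
      · rw [hu]; norm_num
      · rw [hv]; norm_num
  obtain ⟨H, hH⟩ := rho_ker p (g := (thG u v A' B')^[m] F' - A' ^ m * G) (by
    rw [map_sub, itr, hGK, map_mul, map_pow, hG, sub_self])
  refine ⟨iot p G, iot p H, iot_int p G, iot_int p H, ?_⟩
  rw [← iti, ← map_pow, ← map_mul, ← map_natCast (iot p), ← map_mul, ← map_add, ← hH]
  congr 1
  ring
end
end

section
/- Let p ≥ 5 be a prime. Then D^pP is a modular form mod p; precisely, there exists a polynomial G ∈ ℤ_(p)[Q,R], isobaric of weight 2p+2 and not involving P, such that D^pP − G ∈ p·ℤ_(p)[P,Q,R]. -/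
open MvPolynomial Finset

noncomputable section

theorem pInt_add {p : ℕ} (hp : p.Prime) {x y : ℚ} (hx : pInt p x) (hy : pInt p y) :
    pInt p (x + y) := fun h =>
  ((hp.dvd_mul).1 (h.trans (Rat.add_den_dvd x y))).elim hx hy

theorem pInt_mul {p : ℕ} (hp : p.Prime) {x y : ℚ} (hx : pInt p x) (hy : pInt p y) :
    pInt p (x * y) := fun h =>
  ((hp.dvd_mul).1 (h.trans (Rat.mul_den_dvd x y))).elim hx hy

theorem pInt_natCast {p : ℕ} (hp : p.Prime) (n : ℕ) : pInt p n := by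
  simp [pInt, hp.one_lt.ne']

theorem pInt_inv {p : ℕ} (n : ℕ) (hn : ¬ p ∣ n) : pInt p ((n : ℚ)⁻¹) := by
  have h0 : n ≠ 0 := by rintro rfl; simp at hn
  simpa [pInt, Rat.inv_natCast_den, h0] using hn

/-- The subring of `p`-integral rationals. -/
def pIntS (p : ℕ) (hp : p.Prime) : Subring ℚ where
  carrier := {x | pInt p x}
  mul_mem' := pInt_mul hp
  one_mem' := by simpa using pInt_natCast hp 1
  add_mem' := pInt_add hp
  zero_mem' := by simpa using pInt_natCast hp 0
  neg_mem' := by intro x hx; simpa [pInt] using hx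

/-- The subring of polynomials with `p`-integral coefficients. -/
def polyS (p : ℕ) (hp : p.Prime) : Subring Poly3 where
  carrier := {f | polyPInt p f}
  mul_mem' := by
    intro f g hf hg m
    rw [coeff_mul]
    exact (pIntS p hp).sum_mem fun x _ => pInt_mul hp (hf _) (hg _)
  one_mem' := by
    intro m
    rw [coeff_one]
    split_ifs
    · exact (pIntS p hp).one_mem
    · exact (pIntS p hp).zero_mem
  add_mem' := by
    intro f g hf hg m
    rw [coeff_add]
    exact pInt_add hp (hf m) (hg m)
  zero_mem' := fun m => by rw [coeff_zero]; exact (pIntS p hp).zero_mem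
  neg_mem' := fun {f} hf m => by rw [coeff_neg]; exact (pIntS p hp).neg_mem (hf m)

theorem X_mem (p : ℕ) (hp : p.Prime) (i : Fin 3) : (X i : Poly3) ∈ polyS p hp := by
  intro m
  rw [coeff_X]
  split_ifs
  · exact (pIntS p hp).one_mem
  · exact (pIntS p hp).zero_mem

theorem C_mem (p : ℕ) (hp : p.Prime) (a : ℚ) (ha : pInt p a) : (C a : Poly3) ∈ polyS p hp := by
  intro m
  rw [coeff_C]
  split_ifs
  · exact ha
  · exact (pIntS p hp).zero_mem

theorem pderiv_mem (p : ℕ) (hp : p.Prime) (i : Fin 3) (f : Poly3) (hf : f ∈ polyS p hp) :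
    pderiv i f ∈ polyS p hp := by
  intro m
  rw [coeff_pderiv]
  exact pInt_mul hp (hf _) (by exact_mod_cast pInt_natCast hp (m i + 1))

theorem not_dvd_twelve {p : ℕ} (hp : p.Prime) (hp5 : 5 ≤ p) : ¬ p ∣ 12 := by
  intro h
  have : p ∣ 2 * 2 * 3 := h
  rw [hp.dvd_mul, hp.dvd_mul] at this
  rcases this with (h | h) | h <;> have := Nat.le_of_dvd (by norm_num) h <;> omega

theorem Dop_mem (p : ℕ) (hp : p.Prime) (hp5 : 5 ≤ p) (f : Poly3) (hf : f ∈ polyS p hp) :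
    Dop f ∈ polyS p hp := by
  have h12 : pInt p (1/12) := by
    simpa using pInt_inv 12 (not_dvd_twelve hp hp5)
  have h3 : pInt p (1/3) := by
    have := pInt_mul hp (pInt_natCast hp 4) h12
    norm_num at this ⊢; exact this
  have h2 : pInt p (1/2) := by
    have := pInt_mul hp (pInt_natCast hp 6) h12
    norm_num at this ⊢; exact this
  have hX := X_mem p hp
  have hd := fun i => pderiv_mem p hp i f hf
  unfold Dop
  refine add_mem (add_mem ?_ ?_) ?_
  · exact mul_mem (mul_mem (C_mem p hp _ h12) (sub_mem (pow_mem (hX 0) 2) (hX 1))) (hd 0)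
  · exact mul_mem (mul_mem (C_mem p hp _ h3) (sub_mem (mul_mem (hX 0) (hX 1)) (hX 2))) (hd 1)
  · exact mul_mem (mul_mem (C_mem p hp _ h2) (sub_mem (mul_mem (hX 0) (hX 2))
      (pow_mem (hX 1) 2))) (hd 2)

theorem Dop_iter_mem (p : ℕ) (hp : p.Prime) (hp5 : 5 ≤ p) (n : ℕ) :
    Dop^[n] (X 0 : Poly3) ∈ polyS p hp := by
  induction n with
  | zero => exact X_mem p hp 0
  | succ n ih => rw [Function.iterate_succ_apply']; exact Dop_mem p hp hp5 _ ih

/-- `D` as a derivation. -/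
def DD : Derivation ℚ Poly3 Poly3 :=
  (C (1/12 : ℚ) * (X 0 ^ 2 - X 1) : Poly3) • pderiv 0
    + (C (1/3 : ℚ) * (X 0 * X 1 - X 2) : Poly3) • pderiv 1
    + (C (1/2 : ℚ) * (X 0 * X 2 - X 1 ^ 2) : Poly3) • pderiv 2

theorem DD_apply (f : Poly3) : DD f = Dop f := by
  simp [DD, Dop]

/-- The Euler (weight) derivation. -/
def EE : Derivation ℚ Poly3 Poly3 :=
  (C 2 * X 0 : Poly3) • pderiv 0 + (C 4 * X 1 : Poly3) • pderiv 1
    + (C 6 * X 2 : Poly3) • pderiv 2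

/-- `12 ∂/∂P`. -/
def dd : Derivation ℚ Poly3 Poly3 := (C 12 : Poly3) • pderiv 0

theorem C_cancel3 : (C (1/3 : ℚ) : Poly3) = 4 * C (1/12) := by
  rw [← map_ofNat (C : ℚ →+* Poly3) 4, ← C_mul]; norm_num
theorem C_cancel2 : (C (1/2 : ℚ) : Poly3) = 6 * C (1/12) := by
  rw [← map_ofNat (C : ℚ →+* Poly3) 6, ← C_mul]; norm_num
theorem C_cancel12 : (12 * C (1/12 : ℚ) : Poly3) = 1 := by
  rw [← map_ofNat (C : ℚ →+* Poly3) 12, ← C_mul]; norm_num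

theorem pderiv_num2 (i : Fin 3) : pderiv i (2 : Poly3) = 0 := by
  rw [← map_ofNat (C : ℚ →+* Poly3) 2, pderiv_C]

theorem pderiv_num4 (i : Fin 3) : pderiv i (4 : Poly3) = 0 := by
  rw [← map_ofNat (C : ℚ →+* Poly3) 4, pderiv_C]

theorem pderiv_num6 (i : Fin 3) : pderiv i (6 : Poly3) = 0 := by
  rw [← map_ofNat (C : ℚ →+* Poly3) 6, pderiv_C]

theorem pderiv_num12 (i : Fin 3) : pderiv i (12 : Poly3) = 0 := by
  rw [← map_ofNat (C : ℚ →+* Poly3) 12, pderiv_C]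

theorem comm_dD : ⁅dd, DD⁆ = EE := by
  have h := C_cancel12
  apply derivation_ext
  intro i
  rw [Derivation.commutator_apply]
  fin_cases i <;>
  simp only [dd, DD, EE, C_cancel2, C_cancel3, map_ofNat] <;>
  generalize hc : (C (1/12 : ℚ) : Poly3) = c at h <;>
  have hd : ∀ i, pderiv i c = 0 := (fun i => by rw [← hc, pderiv_C]) <;>
  simp [pderiv_X, hd, pderiv_num2, pderiv_num4, pderiv_num6, pderiv_num12] <;>
  first
    | linear_combination (2 * X 0) * h
    | linear_combination (4 * X 1) * h
    | linear_combination (6 * X 2) * h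

theorem comm_ED : ⁅EE, DD⁆ = (2 : ℚ) • DD := by
  apply derivation_ext
  intro i
  rw [Derivation.commutator_apply]
  fin_cases i <;>
  simp only [dd, DD, EE, C_cancel2, C_cancel3, map_ofNat] <;>
  generalize hc : (C (1/12 : ℚ) : Poly3) = c <;>
  have hd : ∀ i, pderiv i c = 0 := (fun i => by rw [← hc, pderiv_C]) <;>
  simp [pderiv_X, hd, pderiv_num2, pderiv_num4, pderiv_num6, pderiv_num12, two_smul] <;>
  ring

theorem EE_iter (n : ℕ) : EE (Dop^[n] (X 0)) = ((2 * n + 2 : ℕ) : ℚ) • Dop^[n] (X 0 : Poly3) := by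
  induction n with
  | zero => simp [EE, pderiv_X, smul_eq_C_mul]
  | succ n ih =>
    rw [Function.iterate_succ_apply']
    set f := Dop^[n] (X 0 : Poly3)
    have h := congrArg (fun d => d f) comm_ED
    simp only [Derivation.commutator_apply, ih, Derivation.map_smul, Derivation.smul_apply,
      DD_apply] at h
    rw [sub_eq_iff_eq_add.1 h, ← add_smul]
    congr 1; push_cast; ring

theorem dd_iter (n : ℕ) : dd (Dop^[n+1] (X 0)) =
    (((n + 1) * (n + 2) : ℕ) : ℚ) • Dop^[n] (X 0 : Poly3) := by
  induction n with
  | zero =>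
    have h := congrArg (fun d => d (X 0)) comm_dD
    simp only [Derivation.commutator_apply, DD_apply] at h
    have h1 : Dop (dd (X 0)) = 0 := by simp [← DD_apply, dd]
    rw [h1, sub_zero] at h
    simp only [Function.iterate_succ_apply', Function.iterate_zero, id]
    rw [h]
    simpa using EE_iter 0
  | succ n ih =>
    rw [Function.iterate_succ_apply']
    have h := congrArg (fun d => d (Dop^[n+1] (X 0))) comm_dD
    simp only [Derivation.commutator_apply, EE_iter, ih, Derivation.map_smul,
      DD_apply, ← Function.iterate_succ_apply' Dop n] at h
    rw [sub_eq_iff_eq_add.1 h, ← add_smul]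
    congr 1; push_cast; ring

theorem coeff_X_mul_pd (i : Fin 3) (f : Poly3) (m : Fin 3 →₀ ℕ) :
    coeff m (X i * pderiv i f) = m i * coeff m f := by
  rw [coeff_X_mul']
  split_ifs with h
  · have h1 : 1 ≤ m i := Nat.one_le_iff_ne_zero.2 (Finsupp.mem_support_iff.1 h)
    have h2 : m - Finsupp.single i 1 + Finsupp.single i 1 = m :=
      tsub_add_cancel_of_le (Finsupp.single_le_iff.2 h1)
    rw [coeff_pderiv, h2]
    simp [Nat.cast_sub h1, mul_comm]
  · simp [Finsupp.notMem_support_iff.1 h]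

theorem iter_isobaric (n : ℕ) : Isobaric (2 * n + 2) (Dop^[n] (X 0)) := by
  intro m hm
  have h := congrArg (coeff m) (EE_iter n)
  simp only [EE, Derivation.add_apply, Derivation.smul_apply, smul_eq_mul, mul_assoc, coeff_add,
    coeff_C_mul, coeff_X_mul_pd, coeff_smul] at h
  have h0 := mem_support_iff.1 hm
  have h2 : ((2 * m 0 + 4 * m 1 + 6 * m 2 : ℕ) : ℚ) = ((2 * n + 2 : ℕ) : ℚ) := by
    apply mul_right_cancel₀ h0
    rw [← h]; push_cast; ring
  exact_mod_cast h2

theorem stmt_9 (p : ℕ) (hp : p.Prime) (hp5 : 5 ≤ p) :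
    ∃ G H : Poly3, Isobaric (2 * p + 2) G ∧ NoP G ∧ polyPInt p G ∧
      polyPInt p H ∧ Dop^[p] (X 0 : Poly3) - G = (p : Poly3) * H := by
  obtain ⟨n, rfl⟩ : ∃ n, p = n + 1 := ⟨p - 1, by omega⟩
  set f := Dop^[n+1] (X 0 : Poly3) with hf
  have hfi : polyPInt (n+1) f := Dop_iter_mem _ hp hp5 _
  have hw := iter_isobaric (n+1)
  rw [← hf] at hw
  let G : Poly3 := ∑ m ∈ f.support.filter (fun m => m 0 = 0), monomial m (coeff m f)
  have hG : ∀ m, coeff m G = if m 0 = 0 then coeff m f else 0 := by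
    intro m
    simp only [G, coeff_sum, coeff_monomial, Finset.sum_ite_eq', Finset.mem_filter,
      mem_support_iff]
    by_cases h : coeff m f = 0 <;> simp [h]
  have hp0 : ((n+1 : ℕ) : ℚ) ≠ 0 := by positivity
  have key : ∀ m : Fin 3 →₀ ℕ, (m 0 : ℚ) * coeff m f = ((n+1 : ℕ) : ℚ) *
      (((n+2 : ℕ) : ℚ) * (12 : ℚ)⁻¹ * coeff m (X 0 * Dop^[n] (X 0 : Poly3))) := by
    intro m
    have h := congrArg (fun g => coeff m (X 0 * g)) (dd_iter n)
    simp only [dd, Derivation.smul_apply, smul_eq_mul, mul_left_comm (X 0 : Poly3), coeff_C_mul,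
      smul_eq_C_mul, coeff_X_mul_pd] at h
    rw [← hf] at h
    push_cast at h ⊢
    linear_combination h / 12
  refine ⟨G, C ((n+1 : ℕ) : ℚ)⁻¹ * (f - G), ?_, ?_, ?_, ?_, ?_⟩
  · intro m hm
    rw [mem_support_iff, hG] at hm
    exact hw m (mem_support_iff.2 fun h => hm (by simp [h]))
  · intro m hm
    rw [mem_support_iff, hG] at hm
    by_contra h
    simp [h] at hm
  · intro m
    rw [hG]
    split_ifs
    · exact hfi m
    · exact (pIntS _ hp).zero_mem
  · intro m
    rw [coeff_C_mul, coeff_sub, hG]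
    split_ifs with h
    · rw [sub_self, mul_zero]; exact (pIntS _ hp).zero_mem
    rw [sub_zero]
    by_cases hc : coeff m f = 0
    · rw [hc, mul_zero]; exact (pIntS _ hp).zero_mem
    have hwm := hw m (mem_support_iff.2 hc)
    have hnd : ¬ (n+1) ∣ m 0 := by
      rintro ⟨k, hk⟩
      rcases k with _ | _ | k
      · omega
      · omega
      · have : (n+1) * (k + 1 + 1) = (n+1) * k + 2 * (n+1) := by ring
        have : 0 ≤ (n+1) * k := Nat.zero_le _
        omega
    have hm0 : (m 0 : ℚ) ≠ 0 := by exact_mod_cast h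
    have : ((n+1 : ℕ) : ℚ)⁻¹ * coeff m f = ((m 0 : ℕ) : ℚ)⁻¹ *
        (((n+2 : ℕ) : ℚ) * ((12 : ℕ) : ℚ)⁻¹ * coeff m (X 0 * Dop^[n] (X 0 : Poly3))) := by
      have k := key m
      rw [inv_mul_eq_iff_eq_mul₀ hp0, mul_left_comm, eq_inv_mul_iff_mul_eq₀ hm0, k]
      norm_num
    rw [this]
    exact pInt_mul hp (pInt_inv _ hnd) (pInt_mul hp (pInt_mul hp (pInt_natCast hp _)
      (pInt_inv _ (not_dvd_twelve hp hp5)))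
      (mul_mem (X_mem _ hp 0) (Dop_iter_mem _ hp hp5 n) m))
  · rw [← map_natCast (C : ℚ →+* Poly3), ← mul_assoc, ← C_mul, mul_inv_cancel₀ hp0, C_1, one_mul]
end
end
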